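/- Let λ, μ ∈ ℝ with μ > 0 and 3λ + 2μ > 0, and let r₀, E₀ > 0, D₀ > 1. There exists a constant c > 0, depending only on λ, μ, r₀, E₀, D₀, such that for every Lipschitz cavity C with parameters r₀, E₀, D₀ and every continuously differentiable u : Ω → ℝ³ on Ω = ℝ³₋ \ C̄ with ∫_Ω |u|²/(1+|x|²) dx < ∞ and ∫_Ω |∇u|² dx < ∞, the elastic energy satisfies ∫_Ω ℂ∇̂u : ∇̂u dx ≥ c ( ∫_Ω |u|²/(1+|x|²) dx + ∫_Ω |∇u|² dx ), i.e. the bilinear form a(u,u) = ∫_Ω ℂ∇̂u : ∇̂u dx is coercive on the weighted space. -/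

import Mathlib

open MeasureTheory Metric Set

noncomputable section

abbrev E3 := EuclideanSpace ℝ (Fin 3)
abbrev E2 := EuclideanSpace ℝ (Fin 2)

/-- The open lower half-space `{x : x₃ < 0}`. -/
def lowerHalf : Set E3 := {x | x 2 < 0}

/-- The lower half-ball `B⁻_r(0) = {|x| < r, x₃ < 0}`. -/
def negBall (r : ℝ) : Set E3 := {x | ‖x‖ < r ∧ x 2 < 0}

/-- Jacobian matrix of a vector field: `(jac u x) i j = ∂uᵢ/∂xⱼ (x)`. -/
def jac (u : E3 → E3) (x : E3) : Matrix (Fin 3) (Fin 3) ℝ :=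
  fun i j => fderiv ℝ u x (EuclideanSpace.single j 1) i

/-- Symmetric part of the Jacobian (strain tensor) `∇̂u`. -/
def strain (u : E3 → E3) (x : E3) : Matrix (Fin 3) (Fin 3) ℝ :=
  fun i j => (jac u x i j + jac u x j i) / 2

/-- Squared Frobenius norm of a 3×3 matrix. -/
def frob2 (M : Matrix (Fin 3) (Fin 3) ℝ) : ℝ := ∑ i, ∑ j, (M i j)^2

/-- Divergence of a vector field. -/
def divg (u : E3 → E3) (x : E3) : ℝ := ∑ i, jac u x i i

/-- Projection on the first two coordinates. -/
def proj12 (x : E3) : E2 :=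
  (x 0) • EuclideanSpace.single 0 1 + (x 1) • EuclideanSpace.single 1 1

/-- Embedding of the plane `{x₃ = 0}` into `ℝ³`: `x' ↦ (x'₁, x'₂, 0)`. -/
def emb2 (x' : E2) : E3 :=
  (x' 0) • EuclideanSpace.single 0 1 + (x' 1) • EuclideanSpace.single 1 1

/-- Partial derivative of a scalar field in the k-th coordinate direction. -/
def pd (f : E3 → ℝ) (k : Fin 3) (x : E3) : ℝ := fderiv ℝ f x (EuclideanSpace.single k 1)

/-- `S` has boundary of Lipschitz class with constants r₀, E₀: at each boundary point `P`,
after a rigid change of coordinates sending `P` to `0`, the set is locally the open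
epigraph of a Lipschitz function `ψ` with `ψ 0 = 0` and Lipschitz constant at most `E₀`. -/
def HasLipschitzBoundary (r₀ E₀ : ℝ) (S : Set E3) : Prop :=
  ∀ P ∈ frontier S, ∃ (φ : E3 ≃ᵢ E3) (ψ : E2 → ℝ),
    φ P = 0 ∧ ψ 0 = 0 ∧ LipschitzOnWith (Real.toNNReal E₀) ψ (Metric.ball 0 r₀) ∧
    (φ '' S) ∩ Metric.ball 0 r₀ = {x ∈ Metric.ball (0 : E3) r₀ | ψ (proj12 x) < x 2}

/-- `S` has boundary of class C³ with constants r₀, E₀. -/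
def HasC3Boundary (r₀ E₀ : ℝ) (S : Set E3) : Prop :=
  ∀ P ∈ frontier S, ∃ (φ : E3 ≃ᵢ E3) (ψ : E2 → ℝ),
    φ P = 0 ∧ ψ 0 = 0 ∧ ContDiff ℝ 3 ψ ∧ fderiv ℝ ψ 0 = 0 ∧
    (∀ x' ∈ Metric.ball (0 : E2) r₀, ∀ k : ℕ, k ≤ 3 → ‖iteratedFDeriv ℝ k ψ x'‖ ≤ E₀) ∧
    (φ '' S) ∩ Metric.ball 0 r₀ = {x ∈ Metric.ball (0 : E3) r₀ | ψ (proj12 x) < x 2}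

/-- Geometric a priori assumptions on a cavity: bounded open set, closure inside the lower
half-space, connected complement in the half-space, contained in `B⁻_{2D₀}(0)`, at distance
at least `D₀` from the plane `{x₃ = 0}`, with diameter less than `D₀`. -/
def IsCavity (D₀ : ℝ) (C : Set E3) : Prop :=
  IsOpen C ∧ Bornology.IsBounded C ∧ closure C ⊆ lowerHalf ∧
  IsConnected (lowerHalf \ closure C) ∧ C ⊆ negBall (2*D₀) ∧
  (∀ x ∈ C, x 2 ≤ -D₀) ∧ Metric.diam C < D₀

/-- Lipschitz cavity with parameters r₀, E₀, D₀. -/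
def IsLipschitzCavity (r₀ E₀ D₀ : ℝ) (C : Set E3) : Prop :=
  IsCavity D₀ C ∧ HasLipschitzBoundary r₀ E₀ C

/-- C³ cavity with parameters r₀, E₀, D₀. -/
def IsC3Cavity (r₀ E₀ D₀ : ℝ) (C : Set E3) : Prop :=
  IsCavity D₀ C ∧ HasC3Boundary r₀ E₀ C

section kornproof
open scoped ENNReal NNReal Topology
open Filter


open scoped ENNReal NNReal

lemma cs_lint {α : Type*} [MeasurableSpace α] (μ : Measure α) {f : α → ℝ≥0∞}
    (hf : AEMeasurable f μ) : (∫⁻ x, f x ∂μ)^2 ≤ μ univ * ∫⁻ x, f x ^ 2 ∂μ := by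
  have h := ENNReal.lintegral_mul_le_Lp_mul_Lq μ (p := 2) (q := 2) Real.HolderConjugate.two_two
    (f := fun _ => 1) (g := f) aemeasurable_const hf
  simp only [Pi.mul_apply, one_mul, ENNReal.one_rpow, lintegral_const] at h
  calc (∫⁻ x, f x ∂μ)^2 ≤ ((μ univ) ^ (1/2:ℝ) * (∫⁻ x, f x ^ (2:ℝ) ∂μ) ^ (1/2:ℝ))^2 := by
        gcongr
    _ = _ := by
        rw [mul_pow, ← ENNReal.rpow_natCast, ← ENNReal.rpow_natCast, ← ENNReal.rpow_mul,
          ← ENNReal.rpow_mul]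
        norm_num

lemma lint_affine (h : E3 → ℝ≥0∞) (a : E3) {r : ℝ} (hr : 0 < r) :
    ∫⁻ x, h (a + r • x) = ENNReal.ofReal ((r^3)⁻¹) * ∫⁻ x, h x := by
  have h1 : ∫⁻ x, h (a + x) = ∫⁻ x, h x := lintegral_add_left_eq_self h a
  rw [← h1]
  have e := lintegral_map_equiv (μ := (volume : Measure E3)) (fun x => h (a + x))
    (Homeomorph.smulOfNeZero r hr.ne').toMeasurableEquiv
  have e2 : ((Homeomorph.smulOfNeZero r hr.ne' : E3 ≃ₜ E3).toMeasurableEquiv : E3 → E3) = (r • ·) := rfl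
  rw [e2, Measure.map_addHaar_smul _ hr.ne'] at e
  simp only [lintegral_smul_measure, finrank_euclideanSpace, Fintype.card_fin] at e
  rw [← e, abs_of_pos (by positivity), smul_eq_mul]

/-- averaging over pairs -/
lemma avg_pair {B : Set E3} (hB : Convex ℝ B) (hBm : MeasurableSet B) (h : E3 → ℝ≥0∞)
    (hh : Measurable h) {t : ℝ} (ht : t ∈ Icc (0:ℝ) 1) :
    ∫⁻ x in B, ∫⁻ y in B, h (x + t • (y - x)) ≤ 8 * volume B * ∫⁻ z in B, h z := by
  have key : ∀ s : ℝ, 1/2 ≤ s → s ≤ 1 → ∀ y ∈ B,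
      ∫⁻ x in B, h ((1-s) • y + s • x) ≤ 8 * ∫⁻ z in B, h z := by
    intro s hs hs1 y hy
    have h1 : ∫⁻ x in B, h ((1-s) • y + s • x) ≤
        ∫⁻ x, (B.indicator h) ((1-s) • y + s • x) := by
      rw [← lintegral_indicator hBm]
      refine lintegral_mono fun x => ?_
      by_cases hx : x ∈ B
      · have : (1-s) • y + s • x ∈ B := hB hy hx (by linarith) (by linarith) (by ring)
        simp [hx, this]
      · simp [hx]
    refine h1.trans ?_
    rw [lint_affine _ _ (by linarith), lintegral_indicator hBm]
    gcongr
    rw [show (8:ℝ≥0∞) = ENNReal.ofReal 8 by norm_num]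
    apply ENNReal.ofReal_le_ofReal
    rw [inv_le_comm₀ (by positivity) (by norm_num)]
    calc (8:ℝ)⁻¹ = (1/2)^3 := by norm_num
      _ ≤ s^3 := by gcongr
  have hm : Measurable (fun p : E3 × E3 => h (p.1 + t • (p.2 - p.1))) := by fun_prop
  rcases le_total (1/2) t with h2 | h2
  · calc _ ≤ ∫⁻ x in B, 8 * ∫⁻ z in B, h z := by
          refine setLIntegral_mono' hBm fun x hx => ?_
          refine le_trans (le_of_eq ?_) (key t h2 ht.2 x hx)
          refine lintegral_congr fun y => ?_
          congr 1
          module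
      _ = _ := by simp; ring
  · rw [lintegral_lintegral_swap hm.aemeasurable]
    calc _ ≤ ∫⁻ x in B, 8 * ∫⁻ z in B, h z := by
          refine setLIntegral_mono' hBm fun x hx => ?_
          refine le_trans (le_of_eq ?_) (key (1-t) (by linarith) (by linarith [ht.1]) x hx)
          refine lintegral_congr fun y => ?_
          congr 1
          module
      _ = _ := by simp; ring

lemma avg_line {B : Set E3} (hB : Convex ℝ B) (hBm : MeasurableSet B) (h : E3 → ℝ≥0∞)
    (hh : Measurable h) :
    ∫⁻ x in B, ∫⁻ y in B, ∫⁻ t in Icc (0:ℝ) 1, h (x + t • (y - x)) ≤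
      8 * volume B * ∫⁻ z in B, h z := by
  have hm3 : Measurable (fun p : (E3 × E3) × ℝ => h (p.1.1 + p.2 • (p.1.2 - p.1.1))) := by fun_prop
  have e1 : ∀ x : E3, ∫⁻ y in B, ∫⁻ t in Icc (0:ℝ) 1, h (x + t • (y - x)) =
      ∫⁻ t in Icc (0:ℝ) 1, ∫⁻ y in B, h (x + t • (y - x)) := by
    intro x
    rw [lintegral_lintegral_swap]
    exact (by fun_prop : Measurable (fun p : E3 × ℝ => h (x + p.2 • (p.1 - x)))).aemeasurable
  simp_rw [e1]
  rw [lintegral_lintegral_swap]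
  · calc _ ≤ ∫⁻ t in Icc (0:ℝ) 1, 8 * volume B * ∫⁻ z in B, h z := by
          refine setLIntegral_mono' measurableSet_Icc fun t ht => ?_
          exact avg_pair hB hBm h hh ht
      _ = _ := by simp
  · have : Measurable (fun p : (E3 × ℝ) × E3 => h (p.1.1 + p.1.2 • (p.2 - p.1.1))) := by fun_prop
    exact (Measurable.lintegral_prod_right' this).aemeasurable

lemma line_gen {G : Type*} [NormedAddCommGroup G] [NormedSpace ℝ G] [CompleteSpace G]
    {F F' : ℝ → G} (hF : ∀ t ∈ Icc (0:ℝ) 1, HasDerivAt F (F' t) t)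
    (hc : ContinuousOn F' (Icc 0 1)) :
    ‖F 1 - F 0‖ₑ ^ 2 ≤ ∫⁻ t in Icc (0:ℝ) 1, ‖F' t‖ₑ ^ 2 := by
  have h1 : ∫ t in (0:ℝ)..1, F' t = F 1 - F 0 :=
    intervalIntegral.integral_eq_sub_of_hasDerivAt
      (fun t ht => hF t (by rwa [uIcc_of_le zero_le_one] at ht))
      (by apply ContinuousOn.intervalIntegrable; rwa [uIcc_of_le zero_le_one])
  rw [← h1, intervalIntegral.integral_of_le zero_le_one, ← integral_Icc_eq_integral_Ioc]
  calc _ ≤ (∫⁻ t in Icc (0:ℝ) 1, ‖F' t‖ₑ) ^ 2 := by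
        gcongr; exact enorm_integral_le_lintegral_enorm _
    _ ≤ _ := by
        refine (cs_lint _ ?_).trans ?_
        · exact (hc.aestronglyMeasurable measurableSet_Icc).enorm
        · simp

lemma sq_add_le_enorm {G : Type*} [NormedAddCommGroup G] (a b : G) :
    ‖a + b‖ₑ ^ 2 ≤ 2 * ‖a‖ₑ ^ 2 + 2 * ‖b‖ₑ ^ 2 := by
  have := add_sq_le (a := ‖a‖) (b := ‖b‖)
  have h2 : ‖a+b‖^2 ≤ 2 * ‖a‖^2 + 2 * ‖b‖^2 := by
    have := norm_add_le a b
    nlinarith [norm_nonneg (a+b), norm_nonneg a, norm_nonneg b]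
  simp only [← ofReal_norm]
  rw [← ENNReal.ofReal_pow (norm_nonneg _), ← ENNReal.ofReal_pow (norm_nonneg _),
    ← ENNReal.ofReal_pow (norm_nonneg _), show (2:ℝ≥0∞) = ENNReal.ofReal 2 by norm_num,
    ← ENNReal.ofReal_mul (by norm_num), ← ENNReal.ofReal_mul (by norm_num),
    ← ENNReal.ofReal_add (by positivity) (by positivity)]
  exact ENNReal.ofReal_le_ofReal h2

/-- derivative along a segment -/
lemma line_u {Ω : Set E3} (hΩ : IsOpen Ω) {u : E3 → E3} (hu : ContDiffOn ℝ 1 u Ω) {x y : E3}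
    (hxy : ∀ t ∈ Icc (0:ℝ) 1, x + t • (y - x) ∈ Ω) :
    ‖u y - u x‖ₑ ^ 2 ≤ ‖y - x‖ₑ^2 * ∫⁻ t in Icc (0:ℝ) 1, ‖fderiv ℝ u (x + t • (y - x))‖ₑ ^ 2 := by
  have hcd : ContinuousOn (fderiv ℝ u) Ω := hu.continuousOn_fderiv_of_isOpen hΩ le_rfl
  have hl : ∀ t : ℝ, HasDerivAt (fun t : ℝ => x + t • (y - x)) (y - x) t := by
    intro t
    simpa using ((hasDerivAt_id t).smul_const (y - x)).const_add x
  have := line_gen (F := fun t => u (x + t • (y - x)))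
    (F' := fun t => fderiv ℝ u (x + t • (y - x)) (y - x)) (fun t ht => by
      have hd : DifferentiableAt ℝ u (x + t • (y - x)) :=
        (hu.differentiableOn one_ne_zero).differentiableAt (hΩ.mem_nhds (hxy t ht))
      exact hd.hasFDerivAt.comp_hasDerivAt t (hl t)) (by
      apply ContinuousOn.clm_apply _ continuousOn_const
      exact hcd.comp (by fun_prop) hxy)
  simp only [one_smul, zero_smul, add_zero, add_sub_cancel] at this
  refine this.trans ?_
  rw [← lintegral_const_mul']
  · refine lintegral_mono fun t => ?_
    rw [← mul_pow, mul_comm]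
    gcongr
    exact ContinuousLinearMap.le_opENorm _ _
  · simp

set_option maxHeartbeats 1000000 in
/-- Poincaré on a ball -/
lemma poincare_ball {Ω : Set E3} (hΩ : IsOpen Ω) {u : E3 → E3} (hu : ContDiffOn ℝ 1 u Ω)
    {x₀ : E3} {ρ : ℝ} (hρ : 0 < ρ) (hB : ball x₀ ρ ⊆ Ω) :
    ∃ c : E3, ∫⁻ x in ball x₀ ρ, ‖u x - c‖ₑ ^ 2 ≤
      ENNReal.ofReal (32 * ρ^2) * ∫⁻ x in ball x₀ ρ, ‖fderiv ℝ u x‖ₑ ^ 2 := by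
  set h : E3 → ℝ≥0∞ := fun x => ‖fderiv ℝ u x‖ₑ ^ 2 with hh
  have hm : Measurable h := (measurable_fderiv ℝ u).enorm.pow_const 2
  have hav := avg_line (convex_ball x₀ ρ) measurableSet_ball h hm
  have hm3 : Measurable (fun p : (E3 × E3) × ℝ => h (p.1.1 + p.2 • (p.1.2 - p.1.1))) := by fun_prop
  have hm2 := Measurable.lintegral_prod_right' (ν := volume.restrict (Icc (0:ℝ) 1)) hm3
  rw [lintegral_lintegral_swap hm2.aemeasurable] at hav
  have hv0 : volume (ball x₀ ρ) ≠ 0 := (measure_ball_pos _ _ hρ).ne'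
  have hvt : volume (ball x₀ ρ) ≠ ∞ := measure_ball_lt_top.ne
  have hm2' : Measurable (fun p : E3 × E3 => ∫⁻ t in Icc (0:ℝ) 1, h (p.2 + t • (p.1 - p.2))) :=
    Measurable.lintegral_prod_right' (f := fun p : (E3 × E3) × ℝ => h (p.1.2 + p.2 • (p.1.1 - p.1.2))) (by fun_prop)
  have hm1 := Measurable.lintegral_prod_right' (ν := volume.restrict (ball x₀ ρ)) hm2'
  obtain ⟨y, hyB, hy⟩ := exists_le_setLAverage hv0 hvt hm1.aemeasurable
  refine ⟨u y, ?_⟩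
  have hy2 : ∫⁻ x in ball x₀ ρ, ∫⁻ t in Icc (0:ℝ) 1, h (x + t • (y - x)) ≤
      8 * ∫⁻ z in ball x₀ ρ, h z := by
    refine hy.trans ?_
    rw [setLAverage_eq]
    refine ENNReal.div_le_of_le_mul ?_
    refine hav.trans (le_of_eq (by ring))
  calc ∫⁻ x in ball x₀ ρ, ‖u x - u y‖ₑ ^ 2
      ≤ ∫⁻ x in ball x₀ ρ, ENNReal.ofReal (4 * ρ^2) * ∫⁻ t in Icc (0:ℝ) 1, h (x + t • (y - x)) := by
        refine setLIntegral_mono' measurableSet_ball fun x hx => ?_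
        rw [← enorm_neg, neg_sub]
        refine (line_u hΩ hu (x := x) (y := y) fun t ht => hB ?_).trans ?_
        · have := (convex_ball x₀ ρ) hx hyB (sub_nonneg.2 ht.2) ht.1 (by ring)
          convert this using 1; module
        · gcongr
          rw [← ofReal_norm, ← ENNReal.ofReal_pow (norm_nonneg _)]
          apply ENNReal.ofReal_le_ofReal
          have : ‖y - x‖ ≤ 2 * ρ := by
            rw [← dist_eq_norm]
            have h1 := mem_ball.1 hx
            have h2 := mem_ball.1 hyB
            have := dist_triangle_right y x x₀
            linarith
          nlinarith [norm_nonneg (y - x)]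
    _ = ENNReal.ofReal (4 * ρ^2) * ∫⁻ x in ball x₀ ρ, ∫⁻ t in Icc (0:ℝ) 1, h (x + t • (y - x)) := by
        rw [lintegral_const_mul' _ _ ENNReal.ofReal_ne_top]
    _ ≤ ENNReal.ofReal (4 * ρ^2) * (8 * ∫⁻ z in ball x₀ ρ, h z) := by gcongr
    _ = _ := by
        rw [← mul_assoc, show (8:ℝ≥0∞) = ENNReal.ofReal 8 by norm_num,
          ← ENNReal.ofReal_mul (by positivity)]
        congr 2; ring


lemma ibp_swap {f g : E3 → ℝ} (hf : ContDiff ℝ 1 f) (hg : ContDiff ℝ 1 g)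
    (hfs : HasCompactSupport f) (hgs : HasCompactSupport g) (a b : E3) :
    ∫ x, fderiv ℝ f x a * fderiv ℝ g x b = ∫ x, fderiv ℝ f x b * fderiv ℝ g x a := by
  have cf : ∀ a, Continuous (fun x => fderiv ℝ f x a) := fun a =>
    (hf.continuous_fderiv one_ne_zero).clm_apply continuous_const
  have cg : ∀ a, Continuous (fun x => fderiv ℝ g x a) := fun a =>
    (hg.continuous_fderiv one_ne_zero).clm_apply continuous_const
  have sf : ∀ a, HasCompactSupport (fun x => fderiv ℝ f x a) := fun a => hfs.fderiv_apply ℝ a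
  have sg : ∀ a, HasCompactSupport (fun x => fderiv ℝ g x a) := fun a => hgs.fderiv_apply ℝ a
  have lim : ∀ (f g : E3 → ℝ), ContDiff ℝ 1 f → HasCompactSupport f →
      (Continuous (fun x => fderiv ℝ g x b)) → HasCompactSupport (fun x => fderiv ℝ g x b) →
      Tendsto (fun t : ℝ => ∫ x, (t⁻¹ • (f (x + t • a) - f x)) * fderiv ℝ g x b) (𝓝[≠] 0)
        (𝓝 (∫ x, fderiv ℝ f x a * fderiv ℝ g x b)) := by
    intro f g hf hfs cg sg
    obtain ⟨K, hK⟩ := hf.lipschitzWith_of_hasCompactSupport hfs one_ne_zero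
    refine tendsto_integral_filter_of_dominated_convergence
      (fun x => K * ‖a‖ * ‖fderiv ℝ g x b‖) ?_ ?_ ?_ ?_
    · refine Eventually.of_forall fun t => ?_
      have := hf.continuous
      exact (by fun_prop : Continuous _).aestronglyMeasurable
    · refine eventually_nhdsWithin_of_forall fun t ht => Eventually.of_forall fun x => ?_
      rw [norm_mul]
      gcongr
      rw [norm_smul, norm_inv]
      have h1 := hK.dist_le_mul (x + t • a) x
      rw [dist_eq_norm, dist_eq_norm, add_sub_cancel_left, norm_smul] at h1
      have ht' : 0 < ‖t‖ := norm_pos_iff.2 ht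
      rw [inv_mul_le_iff₀ ht']
      linarith
    · exact ((cg.integrable_of_hasCompactSupport sg).norm).const_mul _
    · refine Eventually.of_forall fun x => ?_
      have := ((hf.differentiable one_ne_zero x).hasFDerivAt.hasLineDerivAt a).tendsto_slope_zero
      exact this.mul_const _
  have L1 := lim f g hf hfs (cg b) (sg b)
  have L2 := lim g f hg hgs (cf b) (sf b)
  have L2' := L2.comp (show Tendsto (fun t : ℝ => -t) (𝓝[≠] 0) (𝓝[≠] 0) by
    refine tendsto_nhdsWithin_iff.2 ⟨?_, ?_⟩
    · have : Tendsto (fun t : ℝ => -t) (𝓝 0) (𝓝 (-0)) := (continuous_neg).tendsto 0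
      rw [neg_zero] at this
      exact this.mono_left nhdsWithin_le_nhds
    · exact eventually_nhdsWithin_of_forall fun t ht => by simpa using ht)
  have eq : ∀ t : ℝ, t ≠ 0 → ∫ x, (t⁻¹ • (f (x + t • a) - f x)) * fderiv ℝ g x b =
      ∫ x, ((-t)⁻¹ • (g (x + (-t) • a) - g x)) * fderiv ℝ f x b := by
    intro t ht
    have hft : ContDiff ℝ 1 (fun x => f (x + t • a)) := hf.comp (by fun_prop)
    have hfts : HasCompactSupport (fun x => f (x + t • a)) :=
      hfs.comp_homeomorph (Homeomorph.addRight (t • a))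
    have hgt : ContDiff ℝ 1 (fun x => g (x + (-t) • a)) := hg.comp (by fun_prop)
    have hgts : HasCompactSupport (fun x => g (x + (-t) • a)) :=
      hgs.comp_homeomorph (Homeomorph.addRight ((-t) • a))
    have ibp : ∀ F : E3 → ℝ, ContDiff ℝ 1 F → HasCompactSupport F →
        ∫ x, F x * fderiv ℝ g x b = - ∫ x, fderiv ℝ F x b * g x := by
      intro F hF hFs
      have cF : Continuous (fun x => fderiv ℝ F x b) :=
        (hF.continuous_fderiv one_ne_zero).clm_apply continuous_const
      refine integral_mul_fderiv_eq_neg_fderiv_mul_of_integrable ?_ ?_ ?_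
        (fun x _ => hF.differentiable one_ne_zero x) (fun x _ => hg.differentiable one_ne_zero x)
      · exact (cF.mul hg.continuous).integrable_of_hasCompactSupport hgs.mul_left
      · exact (hF.continuous.mul (cg b)).integrable_of_hasCompactSupport hFs.mul_right
      · exact (hF.continuous.mul hg.continuous).integrable_of_hasCompactSupport hFs.mul_right
    have i1 := ibp f hf hfs
    have i2 := ibp _ hft hfts
    have tr : ∫ x, fderiv ℝ (fun x => f (x + t • a)) x b * g x =
        ∫ x, fderiv ℝ f x b * g (x + (-t) • a) := by
      have : ∀ x, fderiv ℝ (fun x => f (x + t • a)) x b * g x =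
        (fun y => fderiv ℝ f y b * g (y + (-t) • a)) (x + t • a) := by
        intro x
        simp [fderiv_comp_add_right]
      simp_rw [this]
      exact integral_add_right_eq_self (fun y => fderiv ℝ f y b * g (y + (-t) • a)) (t • a)
    rw [tr] at i2
    have I1 : Integrable (fun x => f (x + t • a) * fderiv ℝ g x b) :=
      (hft.continuous.mul (cg b)).integrable_of_hasCompactSupport hfts.mul_right
    have I2 : Integrable (fun x => f x * fderiv ℝ g x b) :=
      (hf.continuous.mul (cg b)).integrable_of_hasCompactSupport hfs.mul_right
    have I3 : Integrable (fun x => fderiv ℝ f x b * g (x + (-t) • a)) :=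
      ((cf b).mul hgt.continuous).integrable_of_hasCompactSupport (sf b).mul_right
    have I4 : Integrable (fun x => fderiv ℝ f x b * g x) :=
      ((cf b).mul hg.continuous).integrable_of_hasCompactSupport (sf b).mul_right
    have e1 : ∀ x, (t⁻¹ • (f (x + t • a) - f x)) * fderiv ℝ g x b =
        t⁻¹ * (f (x + t • a) * fderiv ℝ g x b - f x * fderiv ℝ g x b) := by
      intro x; simp only [smul_eq_mul]; ring
    have e2 : ∀ x, ((-t)⁻¹ • (g (x + (-t) • a) - g x)) * fderiv ℝ f x b =
        (-t)⁻¹ * (fderiv ℝ f x b * g (x + (-t) • a) - fderiv ℝ f x b * g x) := by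
      intro x; simp only [smul_eq_mul]; ring
    simp_rw [e1, e2]
    rw [integral_const_mul, integral_const_mul, integral_sub I1 I2, integral_sub I3 I4, i1, i2]
    rw [inv_neg]; ring
  have L1' := L1.congr' (eventually_nhdsWithin_of_forall fun t ht => eq t ht)
  have : (𝓝[≠] (0:ℝ)).NeBot := inferInstance
  have := tendsto_nhds_unique (l := 𝓝[≠] (0:ℝ)) L1' L2'
  rw [this]
  congr 1; ext x; ring

lemma jac_eq {u : E3 → E3} {x : E3} (h : DifferentiableAt ℝ u x) (i j : Fin 3) :
    jac u x i j = fderiv ℝ (fun y => u y i) x (EuclideanSpace.single j 1) := by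
  have h1 : HasFDerivAt (fun y => u y i)
      ((EuclideanSpace.proj i : E3 →L[ℝ] ℝ).comp (fderiv ℝ u x)) x :=
    (EuclideanSpace.proj i : E3 →L[ℝ] ℝ).hasFDerivAt.comp x h.hasFDerivAt
  rw [h1.fderiv]; rfl

lemma korn1 {v : E3 → E3} (hv : ContDiff ℝ 1 v) (hvs : HasCompactSupport v) :
    ∫ x, frob2 (jac v x) ≤ ∫ x, 2 * frob2 (strain v x) := by
  have hc : ∀ i, ContDiff ℝ 1 (fun y => v y i) := fun i =>
    (EuclideanSpace.proj i : E3 →L[ℝ] ℝ).contDiff.comp hv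
  have hs : ∀ i, HasCompactSupport (fun y => v y i) := fun i =>
    hvs.comp_left (g := fun z : E3 => z i) rfl
  have hj : ∀ x i j, jac v x i j = fderiv ℝ (fun y => v y i) x (EuclideanSpace.single j 1) :=
    fun x i j => jac_eq (hv.differentiable one_ne_zero x) i j
  have cj : ∀ i j, Continuous (fun x => jac v x i j) := by
    intro i j; simp_rw [hj]
    exact ((hc i).continuous_fderiv one_ne_zero).clm_apply continuous_const
  have sj : ∀ i j, HasCompactSupport (fun x => jac v x i j) := by
    intro i j; simp_rw [hj]; exact (hs i).fderiv_apply ℝ _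
  have I : ∀ i j k l, Integrable (fun x => jac v x i j * jac v x k l) := fun i j k l =>
    ((cj i j).mul (cj k l)).integrable_of_hasCompactSupport (sj i j).mul_right
  have sw : ∀ i j, ∫ x, jac v x i j * jac v x j i = ∫ x, jac v x i i * jac v x j j := by
    intro i j
    simp_rw [hj]
    exact ibp_swap (hc i) (hc j) (hs i) (hs j) _ _
  have e1 : ∀ x, frob2 (jac v x) = ∑ i, ∑ j, jac v x i j * jac v x i j := by
    intro x; simp [frob2, sq]
  have e2 : ∀ x, 2 * frob2 (strain v x) = ∑ i, ∑ j, jac v x i j * jac v x i j +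
      ∑ i, ∑ j, jac v x i j * jac v x j i := by
    intro x; simp only [frob2, strain, Fin.sum_univ_three]; ring
  have I1 : Integrable (fun x => ∑ i, ∑ j, jac v x i j * jac v x i j) :=
    integrable_finsetSum _ fun i _ => integrable_finsetSum _ fun j _ => I _ _ _ _
  have I2 : Integrable (fun x => ∑ i, ∑ j, jac v x i j * jac v x j i) :=
    integrable_finsetSum _ fun i _ => integrable_finsetSum _ fun j _ => I _ _ _ _
  simp_rw [e1, e2]
  rw [integral_add I1 I2]
  have e3 : ∫ x, ∑ i, ∑ j, jac v x i j * jac v x j i = ∫ x, (∑ i, jac v x i i)^2 := by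
    have : ∀ x, (∑ i, jac v x i i)^2 = ∑ i, ∑ j, jac v x i i * jac v x j j := by
      intro x; rw [sq, Finset.sum_mul_sum]
    simp_rw [this]
    rw [integral_finsetSum _ fun i _ => integrable_finsetSum _ fun j _ => I _ _ _ _,
      integral_finsetSum _ fun i _ => integrable_finsetSum _ fun j _ => I _ _ _ _]
    refine Finset.sum_congr rfl fun i _ => ?_
    rw [integral_finsetSum _ fun j _ => I _ _ _ _, integral_finsetSum _ fun j _ => I _ _ _ _]
    exact Finset.sum_congr rfl fun j _ => sw i j
  rw [e3]
  have : 0 ≤ ∫ x, (∑ i, jac v x i i)^2 := integral_nonneg fun x => sq_nonneg _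
  linarith


/-- strain density -/
def es (u : E3 → E3) (x : E3) : ℝ≥0∞ := ENNReal.ofReal (frob2 (strain u x))

lemma measurable_jac (u : E3 → E3) (i j : Fin 3) : Measurable (fun x => jac u x i j) := by
  have h1 : Measurable (fun x => fderiv ℝ u x (EuclideanSpace.single j 1)) :=
    measurable_fderiv_apply_const ℝ u _
  exact (EuclideanSpace.proj i : E3 →L[ℝ] ℝ).continuous.measurable.comp h1

lemma measurable_es (u : E3 → E3) : Measurable (es u) := by
  unfold es frob2 strain
  have := measurable_jac u
  fun_prop

lemma frob2_nonneg (M : Matrix (Fin 3) (Fin 3) ℝ) : 0 ≤ frob2 M := by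
  unfold frob2; positivity

lemma vec_expand (d : E3) : d = ∑ j, d j • EuclideanSpace.single j (1:ℝ) := by
  ext i; fin_cases i <;> simp [Fin.sum_univ_three]

lemma inner_eq_sum (a b : E3) : inner ℝ a b = ∑ i, a i * b i := by
  simp [PiLp.inner_apply, mul_comm]

lemma fderiv_apply_sum (u : E3 → E3) (x d : E3) (i : Fin 3) :
    fderiv ℝ u x d i = ∑ j, jac u x i j * d j := by
  conv_lhs => rw [vec_expand d]
  simp [map_sum, jac, mul_comm]

lemma quad_bound (S : Matrix (Fin 3) (Fin 3) ℝ) (d : E3) :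
    (∑ i, ∑ j, S i j * (d i * d j))^2 ≤ frob2 S * ‖d‖^4 := by
  have h := Finset.sum_mul_sq_le_sq_mul_sq (Finset.univ : Finset (Fin 3 × Fin 3))
    (fun p => S p.1 p.2) (fun p => d p.1 * d p.2)
  rw [Fintype.sum_prod_type, Fintype.sum_prod_type, Fintype.sum_prod_type] at h
  refine h.trans (le_of_eq ?_)
  have : ‖d‖^4 = (‖d‖^2)^2 := by ring
  rw [this, EuclideanSpace.norm_sq_eq]
  simp only [frob2, Fin.sum_univ_three, Real.norm_eq_abs, sq_abs]
  ring

lemma q_bound {Ω : Set E3} (hΩ : IsOpen Ω) {u : E3 → E3} (hu : ContDiffOn ℝ 1 u Ω) {x y : E3}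
    (hxy : ∀ t ∈ Icc (0:ℝ) 1, x + t • (y - x) ∈ Ω) :
    ‖(inner ℝ (u x - u y) (x - y) : ℝ)‖ₑ ^ 2 ≤
      ENNReal.ofReal (‖y - x‖^4) * ∫⁻ t in Icc (0:ℝ) 1, es u (x + t • (y - x)) := by
  have hcd : ContinuousOn (fderiv ℝ u) Ω := hu.continuousOn_fderiv_of_isOpen hΩ le_rfl
  have hl : ∀ t : ℝ, HasDerivAt (fun t : ℝ => x + t • (y - x)) (y - x) t := by
    intro t
    simpa using ((hasDerivAt_id t).smul_const (y - x)).const_add x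
  have := line_gen (F := fun t => (inner ℝ (u (x + t • (y - x))) (y - x) : ℝ))
    (F' := fun t => inner ℝ (fderiv ℝ u (x + t • (y - x)) (y - x)) (y - x)) (fun t ht => by
      have hd : DifferentiableAt ℝ u (x + t • (y - x)) :=
        (hu.differentiableOn one_ne_zero).differentiableAt (hΩ.mem_nhds (hxy t ht))
      have h1 := hd.hasFDerivAt.comp_hasDerivAt t (hl t)
      simpa using h1.inner ℝ (hasDerivAt_const t (y - x))) (by
      apply ContinuousOn.inner _ continuousOn_const
      apply ContinuousOn.clm_apply _ continuousOn_const
      exact hcd.comp (by fun_prop) hxy)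
  simp only [one_smul, zero_smul, add_zero, add_sub_cancel, ← inner_sub_left] at this
  have e : (inner ℝ (u x - u y) (x - y) : ℝ) = inner ℝ (u y - u x) (y - x) := by
    rw [← neg_sub (u y), ← neg_sub y, inner_neg_neg]
  rw [e]
  refine this.trans ?_
  rw [← lintegral_const_mul' _ _ ENNReal.ofReal_ne_top]
  refine lintegral_mono fun t => ?_
  unfold es
  rw [Real.enorm_eq_ofReal_abs, ← ENNReal.ofReal_pow (abs_nonneg _), sq_abs,
    ← ENNReal.ofReal_mul (by positivity)]
  apply ENNReal.ofReal_le_ofReal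
  rw [mul_comm]
  refine le_trans (le_of_eq ?_) (quad_bound _ _)
  rw [inner_eq_sum]
  simp_rw [fderiv_apply_sum]
  simp only [strain, Fin.sum_univ_three]
  ring

abbrev Bh : Set E3 := ball (0:E3) (3/2)

lemma int_Bh {h : E3 → ℝ} (hh : ContinuousOn h (closedBall 0 (3/2))) : IntegrableOn h Bh :=
  (hh.integrableOn_compact (isCompact_closedBall _ _)).mono_set ball_subset_closedBall

lemma mom1 (j : Fin 3) : ∫ y in Bh, y j = 0 := by
  have e : ∫ y : E3 in Bh, (-y) j = ∫ y : E3 in Bh, y j := by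
    rw [← integral_indicator measurableSet_ball, ← integral_indicator measurableSet_ball,
      ← integral_neg_eq_self]
    congr 1; ext y
    simp [indicator]
  have : ∫ y : E3 in Bh, (-y) j = - ∫ y : E3 in Bh, y j := by
    rw [← integral_neg]; rfl
  linarith

def refl3 (j : Fin 3) : E3 ≃ₗᵢ[ℝ] E3 :=
  LinearIsometryEquiv.piLpCongrRight 2 (fun k => if k = j then LinearIsometryEquiv.neg ℝ else
    LinearIsometryEquiv.refl ℝ ℝ)

lemma refl3_apply (j k : Fin 3) (y : E3) : refl3 j y k = if k = j then - y k else y k := by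
  simp only [refl3, LinearIsometryEquiv.piLpCongrRight_apply]
  split_ifs <;> simp

lemma mom2 {i j : Fin 3} (hij : i ≠ j) : ∫ y in Bh, y i * y j = 0 := by
  have e := (refl3 j).measurePreserving.integral_comp (refl3 j).toHomeomorph.measurableEmbedding
    (Bh.indicator (fun y : E3 => y i * y j))
  have e2 : ∀ y : E3, Bh.indicator (fun y : E3 => y i * y j) (refl3 j y) =
      - Bh.indicator (fun y : E3 => y i * y j) y := by
    intro y
    have hm : refl3 j y ∈ Bh ↔ y ∈ Bh := by simp [Bh]
    by_cases hy : y ∈ Bh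
    · rw [indicator_of_mem (hm.2 hy), indicator_of_mem hy, refl3_apply, refl3_apply]
      simp [hij]
    · rw [indicator_of_notMem (mt hm.1 hy), indicator_of_notMem hy, neg_zero]
  simp_rw [e2] at e
  rw [integral_neg, integral_indicator measurableSet_ball] at e
  linarith

def mm (j : Fin 3) : ℝ := ∫ y in Bh, (y : E3) j * y j

lemma mm_pos (j : Fin 3) : 0 < mm j := by
  have hI : IntegrableOn (fun y : E3 => y j * y j) Bh := int_Bh (by fun_prop)
  unfold mm
  rw [setIntegral_pos_iff_support_of_nonneg_ae (Eventually.of_forall fun y => mul_self_nonneg _) hI]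
  have hsub : ball (EuclideanSpace.single j (1:ℝ)) (1/2) ⊆
      Function.support (fun y : E3 => y j * y j) ∩ Bh := by
    intro y hy
    rw [mem_ball, dist_eq_norm] at hy
    constructor
    · have h1 : |y j - 1| < 1/2 := by
        have := PiLp.norm_apply_le (y - EuclideanSpace.single j (1:ℝ)) j
        simp at this
        linarith
      have : 0 < y j := by have := abs_lt.1 h1; linarith
      exact (mul_pos this this).ne'
    · rw [mem_ball_zero_iff]
      have := norm_add_le (y - EuclideanSpace.single j (1:ℝ)) (EuclideanSpace.single j (1:ℝ))
      simp at this
      linarith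
  exact lt_of_lt_of_le (measure_ball_pos _ _ (by norm_num)) (measure_mono hsub)


lemma kp_identity {u : E3 → E3} (hu : ContinuousOn u (closedBall 0 (3/2))) :
    ∃ (a : Matrix (Fin 3) (Fin 3) ℝ) (b : Fin 3 → ℝ),
      (∀ j x, u x j - ∑ i, a j i * x i - b j =
        -(mm j)⁻¹ * ∫ y in Bh, (inner ℝ (u x - u y) (x - y) : ℝ) * y j) ∧
      (∀ i j, mm i * (a i j + a j i) = - ∫ x in Bh, (u x j - ∑ k, a j k * x k - b j) * x i) := by
  have hui : ∀ i, ContinuousOn (fun y => u y i) (closedBall (0:E3) (3/2)) := fun i =>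
    (EuclideanSpace.proj i : E3 →L[ℝ] ℝ).continuous.comp_continuousOn hu
  have I1 : ∀ j, IntegrableOn (fun y : E3 => y j) Bh := fun j => int_Bh (by fun_prop)
  have I2 : ∀ i j, IntegrableOn (fun y : E3 => y i * y j) Bh := fun i j => int_Bh (by fun_prop)
  have I3 : ∀ i j, IntegrableOn (fun y : E3 => u y i * y j) Bh := fun i j =>
    int_Bh ((hui i).mul (by fun_prop))
  have I4 : ∀ i j, IntegrableOn (fun y : E3 => u y i * y i * y j) Bh := fun i j =>
    int_Bh (((hui i).mul (by fun_prop)).mul (by fun_prop))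
  have Ic : Integrable (fun _ : E3 => (1:ℝ)) (volume.restrict Bh) :=
    int_Bh (by fun_prop)
  have m2 : ∀ i j, ∫ y in Bh, (y : E3) i * y j = if i = j then mm j else 0 := by
    intro i j
    split_ifs with h
    · subst h; rfl
    · exact mom2 h
  obtain ⟨A, hA⟩ : ∃ A : Matrix (Fin 3) (Fin 3) ℝ, ∀ j i, A j i =
    -(mm j)⁻¹ * ∫ y in Bh, u y i * y j := ⟨fun j i => _, fun _ _ => rfl⟩
  obtain ⟨b, hb⟩ : ∃ b : Fin 3 → ℝ, ∀ j, b j = (mm j)⁻¹ * ∑ i, ∫ y in Bh, u y i * y i * y j :=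
    ⟨_, fun _ => rfl⟩
  refine ⟨A, b, ?_, ?_⟩
  · intro j x
    have e : ∀ y : E3, (inner ℝ (u x - u y) (x - y) : ℝ) * y j =
        ∑ i, (u x i * x i * y j - u x i * (y i * y j) - x i * (u y i * y j) + u y i * y i * y j) := by
      intro y
      rw [inner_eq_sum, Finset.sum_mul]
      refine Finset.sum_congr rfl fun i _ => ?_
      simp only [PiLp.sub_apply]
      ring
    simp_rw [e]
    rw [integral_finsetSum]
    · have : ∀ i, ∫ y in Bh, (u x i * x i * y j - u x i * (y i * y j) - x i * (u y i * y j)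
            + u y i * y i * y j) =
          - u x i * (if i = j then mm j else 0) - x i * (∫ y in Bh, u y i * y j) +
            ∫ y in Bh, u y i * y i * y j := by
        intro i
        rw [integral_add, integral_sub, integral_sub, integral_const_mul, integral_const_mul,
          integral_const_mul, mom1, m2]
        · ring
        · exact (I1 j).const_mul _
        · exact (I2 i j).const_mul _
        · exact ((I1 j).const_mul _).sub ((I2 i j).const_mul _)
        · exact (I3 i j).const_mul _
        · exact (((I1 j).const_mul _).sub ((I2 i j).const_mul _)).sub ((I3 i j).const_mul _)
        · exact I4 i j
      simp_rw [this]
      rw [Finset.sum_add_distrib, Finset.sum_sub_distrib]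
      have hs : ∑ i, - u x i * (if i = j then mm j else 0) = - u x j * mm j := by
        simp
      rw [hs]
      have hm := (mm_pos j).ne'
      have hs2 : ∑ i, A j i * x i =
          -(mm j)⁻¹ * ∑ i, x i * ∫ y in Bh, u y i * y j := by
        rw [Finset.mul_sum]; refine Finset.sum_congr rfl fun i _ => by rw [hA]; ring
      rw [hs2, hb]
      field_simp
      ring
    · intro i _
      exact ((((I1 j).const_mul _).sub ((I2 i j).const_mul _)).sub ((I3 i j).const_mul _)).add (I4 i j)
  · intro i j
    have e : ∀ x : E3, (u x j - ∑ k, A j k * x k - b j) * x i =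
        u x j * x i - ∑ k, A j k * (x k * x i) - b j * x i := by
      intro x
      rw [sub_mul, sub_mul, Finset.sum_mul]
      congr 2
      refine Finset.sum_congr rfl fun k _ => by ring
    simp_rw [e]
    have IS : Integrable (fun x : E3 => ∑ k, A j k * (x k * x i)) (volume.restrict Bh) :=
      integrable_finsetSum _ fun k _ => (I2 k i).const_mul _
    rw [integral_sub ?_ ?_, integral_sub ?_ ?_,
      integral_const_mul, mom1, integral_finsetSum _ fun k _ => (I2 k i).const_mul _]
    rotate_left
    · exact I3 j i
    · exact IS
    · exact (I3 j i).sub IS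
    · exact (I1 i).const_mul _
    simp_rw [integral_const_mul, m2]
    have hs : ∑ k, A j k * (if k = i then mm i else 0) = A j i * mm i := by simp
    rw [hs]
    have hm := (mm_pos i).ne'
    rw [hA i j]
    field_simp
    ring

lemma kp_bound : ∃ K : ℝ≥0, ∀ u : E3 → E3, ContDiffOn ℝ 1 u (ball 0 2) →
    ∃ (a : Matrix (Fin 3) (Fin 3) ℝ) (b : Fin 3 → ℝ),
      (∀ j, ∫⁻ x in Bh, ‖u x j - ∑ i, a j i * x i - b j‖ₑ^2 ≤ K * ∫⁻ x in Bh, es u x) ∧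
      (∀ i j, ‖a i j + a j i‖ₑ^2 ≤ K * ∫⁻ x in Bh, es u x) := by
  set M : ℝ≥0∞ := ∑ j, ENNReal.ofReal ((mm j)⁻¹)^2 with hM
  have hMt : M ≠ ∞ := by
    rw [hM]; exact ENNReal.sum_ne_top.2 fun j _ => ENNReal.pow_ne_top ENNReal.ofReal_ne_top
  have hMj : ∀ j, ENNReal.ofReal ((mm j)⁻¹)^2 ≤ M := fun j =>
    Finset.single_le_sum (f := fun j => ENNReal.ofReal ((mm j)⁻¹)^2) (fun _ _ => bot_le) (Finset.mem_univ j)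
  set V := volume Bh with hV
  have hVt : V ≠ ∞ := measure_ball_lt_top.ne
  set K1 : ℝ≥0∞ := M * (4 * V * (81 * (8 * V))) with hK1
  have hK1t : K1 ≠ ∞ := by
    rw [hK1]
    have : (81:ℝ≥0∞) ≠ ∞ := by norm_num
    finiteness
  set K2 : ℝ≥0∞ := M * (4 * V * K1) with hK2
  have hK2t : K2 ≠ ∞ := by rw [hK2]; finiteness
  refine ⟨(K1 + K2).toNNReal, fun u hu => ?_⟩
  rw [ENNReal.coe_toNNReal (by finiteness)]
  have hsub : closedBall (0:E3) (3/2) ⊆ ball 0 2 := closedBall_subset_ball (by norm_num)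
  have huc : ContinuousOn u (closedBall 0 (3/2)) := hu.continuousOn.mono hsub
  obtain ⟨a, b, h1, h2⟩ := kp_identity huc
  have hco : ∀ x ∈ Bh, ∀ j : Fin 3, ‖x j‖ₑ ≤ 2 := by
    intro x hx j
    have := PiLp.norm_apply_le x j
    have h3 := mem_ball_zero_iff.1 hx
    rw [← ofReal_norm]
    refine (ENNReal.ofReal_le_ofReal (by linarith : ‖x j‖ ≤ 2)).trans (by norm_num)
  have hB1 : ∀ j, ∫⁻ x in Bh, ‖u x j - ∑ i, a j i * x i - b j‖ₑ^2 ≤ K1 * ∫⁻ x in Bh, es u x := by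
    intro j
    calc _ ≤ ∫⁻ x in Bh, M * (4 * V * (81 * ∫⁻ y in Bh, ∫⁻ t in Icc (0:ℝ) 1, es u (x + t • (y - x)))) := by
          refine setLIntegral_mono' measurableSet_ball fun x hx => ?_
          rw [h1, enorm_mul, mul_pow]
          gcongr
          · rw [enorm_neg, ← ofReal_norm, Real.norm_of_nonneg (inv_nonneg.2 (mm_pos j).le)]
            exact hMj j
          have hqm : AEMeasurable (fun y => ‖(inner ℝ (u x - u y) (x - y) : ℝ)‖ₑ) (volume.restrict Bh) := by
            have : ContinuousOn (fun y => (inner ℝ (u x - u y) (x - y) : ℝ)) Bh := by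
              apply ContinuousOn.inner
              · exact continuousOn_const.sub (huc.mono ball_subset_closedBall)
              · fun_prop
            exact (this.aestronglyMeasurable measurableSet_ball).enorm
          calc _ ≤ (∫⁻ y in Bh, 2 * ‖(inner ℝ (u x - u y) (x - y) : ℝ)‖ₑ)^2 := by
                gcongr
                refine (enorm_integral_le_lintegral_enorm _).trans ?_
                refine setLIntegral_mono' measurableSet_ball fun y hy => ?_
                rw [enorm_mul, mul_comm]
                gcongr
                exact hco y hy j
            _ = 4 * (∫⁻ y in Bh, ‖(inner ℝ (u x - u y) (x - y) : ℝ)‖ₑ)^2 := by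
                rw [lintegral_const_mul' _ _ (by norm_num), mul_pow]; norm_num
            _ ≤ 4 * (V * ∫⁻ y in Bh, ‖(inner ℝ (u x - u y) (x - y) : ℝ)‖ₑ^2) := by
                gcongr
                refine (cs_lint _ hqm).trans ?_
                rw [Measure.restrict_apply_univ]
            _ ≤ 4 * (V * ∫⁻ y in Bh, 81 * ∫⁻ t in Icc (0:ℝ) 1, es u (x + t • (y - x))) := by
                gcongr 4 * (V * ?_)
                refine setLIntegral_mono' measurableSet_ball fun y hy => ?_
                refine (q_bound isOpen_ball hu (fun t ht => hsub (ball_subset_closedBall ?_))).trans ?_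
                · have := (convex_ball (0:E3) (3/2)) hx hy (sub_nonneg.2 ht.2) ht.1 (by ring)
                  convert this using 1; module
                · gcongr
                  rw [show (81:ℝ≥0∞) = ENNReal.ofReal 81 by norm_num]
                  apply ENNReal.ofReal_le_ofReal
                  have : ‖y - x‖ ≤ 3 := by
                    have h1 := mem_ball_zero_iff.1 hx
                    have h2 := mem_ball_zero_iff.1 hy
                    have := norm_sub_le y x
                    linarith
                  calc ‖y-x‖^4 ≤ 3^4 := by gcongr
                    _ = 81 := by norm_num
            _ = _ := by
                rw [lintegral_const_mul' _ _ (by norm_num)]; ring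
      _ = M * (4 * V * (81 * ∫⁻ x in Bh, ∫⁻ y in Bh, ∫⁻ t in Icc (0:ℝ) 1, es u (x + t • (y - x)))) := by
          rw [lintegral_const_mul' _ _ hMt, lintegral_const_mul' _ _ (by finiteness),
            lintegral_const_mul' _ _ (by norm_num)]
      _ ≤ M * (4 * V * (81 * (8 * V * ∫⁻ x in Bh, es u x))) := by
          gcongr
          exact avg_line (convex_ball _ _) measurableSet_ball _ (measurable_es u)
      _ = _ := by rw [hK1]; ring
  refine ⟨a, b, fun j => (hB1 j).trans (by gcongr; exact le_self_add), fun i j => ?_⟩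
  have e : a i j + a j i = (mm i)⁻¹ * (- ∫ x in Bh, (u x j - ∑ k, a j k * x k - b j) * x i) := by
    rw [← h2, inv_mul_cancel_left₀ (mm_pos i).ne']
  have hwm : AEMeasurable (fun x => ‖u x j - ∑ k, a j k * x k - b j‖ₑ) (volume.restrict Bh) := by
    have huj : ContinuousOn (fun y => u y j) Bh :=
      (EuclideanSpace.proj j : E3 →L[ℝ] ℝ).continuous.comp_continuousOn (huc.mono ball_subset_closedBall)
    have : ContinuousOn (fun x => u x j - ∑ k, a j k * x k - b j) Bh := by fun_prop
    exact (this.aestronglyMeasurable measurableSet_ball).enorm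
  rw [e, enorm_mul, mul_pow, enorm_neg]
  calc _ ≤ M * (∫⁻ x in Bh, 2 * ‖u x j - ∑ k, a j k * x k - b j‖ₑ)^2 := by
        gcongr
        · rw [← ofReal_norm, Real.norm_of_nonneg (inv_nonneg.2 (mm_pos i).le)]
          exact hMj i
        · refine (enorm_integral_le_lintegral_enorm _).trans ?_
          refine setLIntegral_mono' measurableSet_ball fun y hy => ?_
          rw [enorm_mul, mul_comm]
          gcongr
          exact hco y hy i
    _ = M * (4 * (∫⁻ x in Bh, ‖u x j - ∑ k, a j k * x k - b j‖ₑ)^2) := by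
        rw [lintegral_const_mul' _ _ (by norm_num), mul_pow]; norm_num
    _ ≤ M * (4 * (V * (K1 * ∫⁻ x in Bh, es u x))) := by
        gcongr
        refine (cs_lint _ hwm).trans ?_
        rw [Measure.restrict_apply_univ]
        gcongr
        exact hB1 j
    _ = K2 * ∫⁻ x in Bh, es u x := by rw [hK2]; ring
    _ ≤ _ := by gcongr; exact le_add_self


def matT (T : E3 →L[ℝ] E3) : Matrix (Fin 3) (Fin 3) ℝ := fun i j => T (EuclideanSpace.single j 1) i

lemma apply_sum (T : E3 →L[ℝ] E3) (d : E3) (i : Fin 3) : T d i = ∑ j, matT T i j * d j := by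
  conv_lhs => rw [vec_expand d]
  simp [matT, Fin.sum_univ_three]; ring

lemma opnorm_frob (T : E3 →L[ℝ] E3) : ‖T‖^2 ≤ frob2 (matT T) := by
  have h : ‖T‖ ≤ √(frob2 (matT T)) := by
    refine T.opNorm_le_bound (Real.sqrt_nonneg _) fun d => ?_
    rw [← Real.sqrt_sq (norm_nonneg (T d)), ← Real.sqrt_sq (norm_nonneg d),
      ← Real.sqrt_mul (frob2_nonneg _)]
    apply Real.sqrt_le_sqrt
    rw [EuclideanSpace.norm_sq_eq, EuclideanSpace.norm_sq_eq, frob2, Finset.sum_mul]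
    refine Finset.sum_le_sum fun i _ => ?_
    rw [apply_sum, Real.norm_eq_abs, sq_abs]
    simp only [Real.norm_eq_abs, sq_abs]
    exact Finset.sum_mul_sq_le_sq_mul_sq _ _ _
  calc ‖T‖^2 ≤ √(frob2 (matT T))^2 := by gcongr
    _ = _ := Real.sq_sqrt (frob2_nonneg _)

lemma frob_opnorm (T : E3 →L[ℝ] E3) : frob2 (matT T) ≤ 9 * ‖T‖^2 := by
  have h : ∀ i j, matT T i j ^ 2 ≤ ‖T‖^2 := by
    intro i j
    rw [← sq_abs]
    gcongr
    have h1 := PiLp.norm_apply_le (T (EuclideanSpace.single j 1)) i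
    have h2 := T.le_opNorm (EuclideanSpace.single j 1)
    have h3 : ‖(EuclideanSpace.single j (1:ℝ) : E3)‖ = 1 := by simp
    rw [h3, mul_one] at h2
    exact h1.trans h2
  unfold frob2
  calc _ ≤ ∑ i : Fin 3, ∑ j : Fin 3, ‖T‖^2 := Finset.sum_le_sum fun i _ => Finset.sum_le_sum fun j _ => h i j
    _ = _ := by simp; ring

lemma enorm_sq_eq {G : Type*} [NormedAddCommGroup G] (a : G) : ‖a‖ₑ^2 = ENNReal.ofReal (‖a‖^2) := by
  rw [← ofReal_norm, ENNReal.ofReal_pow (norm_nonneg _)]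

lemma frob_alg (S a : Matrix (Fin 3) (Fin 3) ℝ) (w d : Fin 3 → ℝ) (η M : ℝ) (h0 : 0 ≤ η) (h1 : η ≤ 1)
    (hd : ∀ i, |d i| ≤ M) :
    frob2 (fun i j => η * (S i j - (a i j + a j i)/2) + (d j * w i + d i * w j)/2) ≤
      3 * frob2 S + ∑ i, ∑ j, (a i j + a j i)^2 + 9 * M^2 * ∑ i, w i ^2 := by
  have key : ∀ i j, (η * (S i j - (a i j + a j i)/2) + (d j * w i + d i * w j)/2)^2 ≤
      3 * (S i j)^2 + (a i j + a j i)^2 + (3/2) * M^2 * (w i^2 + w j^2) := by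
    intro i j
    have hη : η^2 ≤ 1 := by nlinarith
    have hj : (d j)^2 ≤ M^2 := sq_le_sq' (by have := abs_le.1 (hd j); linarith) (abs_le.1 (hd j)).2
    have hi : (d i)^2 ≤ M^2 := sq_le_sq' (by have := abs_le.1 (hd i); linarith) (abs_le.1 (hd i)).2
    set p := S i j
    set q := a i j + a j i
    have e1 : (η * (p - q/2) + (d j * w i + d i * w j)/2)^2 ≤
      3 * (η^2 * p^2) + 3/4 * (η^2 * q^2) + 3/2 * ((d j)^2 * (w i)^2 + (d i)^2 * (w j)^2) := by
      nlinarith [sq_nonneg (η * p + η * q/2), sq_nonneg (η * p - (d j * w i + d i * w j)/2),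
        sq_nonneg (η*q/2 + (d j * w i + d i * w j)/2), sq_nonneg (d j * w i - d i * w j)]
    have e2 := mul_le_mul_of_nonneg_right hη (sq_nonneg p)
    have e3 := mul_le_mul_of_nonneg_right hη (sq_nonneg q)
    have e4 := mul_le_mul_of_nonneg_right hj (sq_nonneg (w i))
    have e5 := mul_le_mul_of_nonneg_right hi (sq_nonneg (w j))
    nlinarith [sq_nonneg q]
  unfold frob2
  calc _ ≤ ∑ i, ∑ j, (3 * (S i j)^2 + (a i j + a j i)^2 + (3/2) * M^2 * (w i^2 + w j^2)) := by
        gcongr with i _ j _; exact key i j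
    _ = _ := by simp only [Fin.sum_univ_three]; ring

lemma korn_unit : ∃ K : ℝ≥0, ∀ u : E3 → E3, ContDiffOn ℝ 1 u (ball 0 2) →
    ∃ A : E3 →L[ℝ] E3, ∫⁻ x in ball 0 1, ‖fderiv ℝ u x - A‖ₑ^2 ≤ K * ∫⁻ x in ball 0 2, es u x := by
  obtain ⟨K, hK⟩ := kp_bound
  let η : ContDiffBump (0:E3) := ⟨1, 3/2, by norm_num, by norm_num⟩
  have hη : ContDiff ℝ 1 η := η.contDiff
  obtain ⟨M, hM⟩ : ∃ M, ∀ x, ‖fderiv ℝ η x‖ ≤ M :=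
    (hη.continuous_fderiv one_ne_zero).bounded_above_of_compact_support (η.hasCompactSupport.fderiv (𝕜 := ℝ))
  have hd : ∀ x i, |fderiv ℝ η x (EuclideanSpace.single i 1)| ≤ M := by
    intro x i
    have h2 := (fderiv ℝ η x).le_opNorm (EuclideanSpace.single i 1)
    have h3 : ‖(EuclideanSpace.single i (1:ℝ) : E3)‖ = 1 := by simp
    rw [h3, mul_one] at h2
    exact h2.trans (hM x)
  set V := volume Bh with hV
  have hVt : V ≠ ∞ := measure_ball_lt_top.ne
  set K1 : ℝ≥0∞ := 2 * (3 + 9 * K * V + ENNReal.ofReal (9 * M^2) * (3 * K)) with hK1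
  have hK1t : K1 ≠ ∞ := by
    have : (9:ℝ≥0∞) ≠ ∞ := by norm_num
    rw [hK1]; finiteness
  refine ⟨K1.toNNReal, fun u hu => ?_⟩
  rw [ENNReal.coe_toNNReal hK1t]
  obtain ⟨a, b, h1, h2⟩ := hK u hu
  let A : E3 →L[ℝ] E3 := Matrix.toEuclideanCLM (𝕜 := ℝ) a
  have hA : ∀ x i, A x i = ∑ j, a i j * x j := fun x i => rfl
  have hAm : ∀ i j, A (EuclideanSpace.single j 1) i = a i j := by
    intro i j; rw [hA]; simp
  let b' : E3 := WithLp.toLp 2 b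
  let w : E3 → E3 := fun x => u x - A x - b'
  have hw : ∀ x i, w x i = u x i - ∑ j, a i j * x j - b i := fun x i => rfl
  let v : E3 → E3 := fun x => η x • w x
  have hwc : ContDiffOn ℝ 1 w (ball 0 2) := (hu.sub A.contDiff.contDiffOn).sub contDiffOn_const
  have hsub : closedBall (0:E3) (3/2) ⊆ ball 0 2 := closedBall_subset_ball (by norm_num)
  have htη : tsupport η = closedBall 0 (3/2) := η.tsupport_eq
  have htv : tsupport v ⊆ closedBall 0 (3/2) := by
    rw [← htη]; exact tsupport_smul_subset_left _ _
  have hv : ContDiff ℝ 1 v := by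
    refine contDiff_iff_contDiffAt.2 fun x => ?_
    by_cases hx : x ∈ tsupport v
    swap
    · exact contDiffAt_const.congr_of_eventuallyEq (notMem_tsupport_iff_eventuallyEq.1 hx)
    exact hη.contDiffAt.smul (hwc.contDiffAt (isOpen_ball.mem_nhds (hsub (htv hx))))
  have hvs : HasCompactSupport v := η.hasCompactSupport.smul_right
  have hud : ∀ x ∈ ball (0:E3) 2, DifferentiableAt ℝ u x := fun x hx =>
    (hu.contDiffAt (isOpen_ball.mem_nhds hx)).differentiableAt one_ne_zero
  have hjv : ∀ x ∈ ball (0:E3) 2, ∀ i j, jac v x i j =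
      η x * (jac u x i j - a i j) + fderiv ℝ η x (EuclideanSpace.single j 1) * w x i := by
    intro x hx i j
    have hwd : HasFDerivAt w (fderiv ℝ u x - A) x :=
      ((hud x hx).hasFDerivAt.sub A.hasFDerivAt).sub_const b'
    have := ((hη.differentiable one_ne_zero x).hasFDerivAt.smul hwd).fderiv
    unfold jac
    rw [show fderiv ℝ v x = _ from this]
    simp [hAm]
  have hjA : ∀ x ∈ ball (0:E3) 1, ‖fderiv ℝ u x - A‖^2 ≤ frob2 (jac v x) := by
    intro x hx
    have hx2 : x ∈ ball (0:E3) 2 := ball_subset_ball (by norm_num) hx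
    refine (opnorm_frob _).trans (le_of_eq ?_)
    congr 1; ext i j
    have e1 : η x = 1 := η.one_of_mem_closedBall (ball_subset_closedBall hx)
    have e2 : fderiv ℝ η x = 0 := by
      have : (η : E3 → ℝ) =ᶠ[𝓝 x] fun _ => 1 := by
        filter_upwards [isOpen_ball.mem_nhds hx] with y hy
        exact η.one_of_mem_closedBall (ball_subset_closedBall hy)
      rw [this.fderiv_eq]; simp
    rw [hjv x hx2, e1, e2]
    simp [matT, jac, hAm]
  have hst : ∀ x, ENNReal.ofReal (frob2 (strain v x)) ≤ Bh.indicator (fun x =>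
      3 * es u x + ∑ i, ∑ j, ‖a i j + a j i‖ₑ^2 + ENNReal.ofReal (9 * M^2) * ∑ i, ‖w x i‖ₑ^2) x := by
    intro x
    by_cases hx : x ∈ Bh
    · rw [indicator_of_mem hx]
      have hx2 : x ∈ ball (0:E3) 2 := ball_subset_ball (by norm_num) hx
      have e : strain v x = fun i j => η x * (strain u x i j - (a i j + a j i)/2) +
        (fderiv ℝ η x (EuclideanSpace.single j 1) * w x i + fderiv ℝ η x (EuclideanSpace.single i 1) * w x j)/2 := by
        ext i j
        simp only [strain]
        rw [hjv x hx2, hjv x hx2]; ring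
      rw [e]
      refine (ENNReal.ofReal_le_ofReal (frob_alg _ a (fun i => w x i) _ (η x) M (η.nonneg) η.le_one (hd x))).trans ?_
      have hs : ∀ t : ℝ, ‖t‖ₑ^2 = ENNReal.ofReal (t^2) := by
        intro t; rw [enorm_sq_eq, Real.norm_eq_abs, sq_abs]
      have f0 := frob2_nonneg (strain u x)
      rw [ENNReal.ofReal_add (by positivity) (by positivity), ENNReal.ofReal_add (by positivity) (by positivity),
        ENNReal.ofReal_mul (by norm_num), ENNReal.ofReal_mul (by positivity),
        ENNReal.ofReal_sum_of_nonneg (by intros; positivity), ENNReal.ofReal_sum_of_nonneg (by intros; positivity)]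
      simp only [hs]
      gcongr with i
      · norm_num
      · unfold es; rfl
      · rw [ENNReal.ofReal_sum_of_nonneg (by intros; positivity)]
    · rw [indicator_of_notMem hx]
      have e : jac v x = 0 := by
        by_cases hx2 : x ∈ ball (0:E3) 2
        · ext i j
          have e1 : η x = 0 := η.zero_of_le_dist (by rw [mem_ball, not_lt] at hx; exact hx)
          have e2 : fderiv ℝ η x = 0 := by
            apply IsLocalMin.fderiv_eq_zero
            refine Filter.Eventually.of_forall fun y => ?_
            show η x ≤ η y
            rw [e1]; exact η.nonneg
          rw [hjv x hx2, e1, e2]; simp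
        · have : fderiv ℝ v x = 0 := by
            have hx3 : x ∉ tsupport v := fun h => hx2 (hsub (htv h))
            rw [(notMem_tsupport_iff_eventuallyEq.1 hx3).fderiv_eq]
            simp
          ext i j
          simp [jac, this]
      have : frob2 (strain v x) = 0 := by
        simp [frob2, strain, e]
      simp [this]
  refine ⟨A, ?_⟩
  have hjc : ∀ i j, Continuous fun x => jac v x i j := by
    intro i j
    have := (hv.continuous_fderiv one_ne_zero)
    unfold jac
    fun_prop
  have hjs : ∀ i j, HasCompactSupport fun x => jac v x i j := by
    intro i j
    have := hvs.fderiv (𝕜 := ℝ)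
    exact this.comp_left (g := fun T : E3 →L[ℝ] E3 => T (EuclideanSpace.single j 1) i) (by simp)
  have hjfr : ∀ x, x ∉ tsupport v → ∀ i j, jac v x i j = 0 := by
    intro x hx i j
    have : fderiv ℝ v x = 0 := by
      rw [(notMem_tsupport_iff_eventuallyEq.1 hx).fderiv_eq]
      simp
    simp [jac, this]
  have i1 : Integrable fun x => frob2 (jac v x) := by
    apply Continuous.integrable_of_hasCompactSupport
    · unfold frob2; fun_prop
    · refine HasCompactSupport.intro hvs.isCompact (fun x hx => ?_)
      simp [frob2, hjfr x hx]
  have i2 : Integrable fun x => 2 * frob2 (strain v x) := by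
    apply Continuous.integrable_of_hasCompactSupport
    · unfold frob2 strain; fun_prop
    · refine HasCompactSupport.intro hvs.isCompact (fun x hx => ?_)
      simp [frob2, strain, hjfr x hx]
  have hwm : ∀ i, AEMeasurable (fun x => ‖w x i‖ₑ^2) (volume.restrict Bh) := by
    intro i
    have : ContinuousOn (fun x => w x i) Bh :=
      (EuclideanSpace.proj i : E3 →L[ℝ] ℝ).continuous.comp_continuousOn
        (hwc.continuousOn.mono (ball_subset_ball (by norm_num)))
    exact ((this.aestronglyMeasurable measurableSet_ball).enorm).pow_const 2
  have hJ : ∫⁻ x in Bh, es u x ≤ ∫⁻ x in ball 0 2, es u x :=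
    lintegral_mono_set (ball_subset_ball (by norm_num))
  calc ∫⁻ x in ball 0 1, ‖fderiv ℝ u x - A‖ₑ^2 ≤ ∫⁻ x in ball (0:E3) 1, ENNReal.ofReal (frob2 (jac v x)) := by
        refine setLIntegral_mono' measurableSet_ball fun x hx => ?_
        rw [enorm_sq_eq]
        exact ENNReal.ofReal_le_ofReal (hjA x hx)
    _ ≤ ∫⁻ x, ENNReal.ofReal (frob2 (jac v x)) := setLIntegral_le_lintegral _ _
    _ = ENNReal.ofReal (∫ x, frob2 (jac v x)) := by
        rw [ofReal_integral_eq_lintegral_ofReal i1 (ae_of_all _ fun x => frob2_nonneg _)]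
    _ ≤ ENNReal.ofReal (∫ x, 2 * frob2 (strain v x)) := ENNReal.ofReal_le_ofReal (korn1 hv hvs)
    _ = ∫⁻ x, 2 * ENNReal.ofReal (frob2 (strain v x)) := by
        rw [ofReal_integral_eq_lintegral_ofReal i2 (ae_of_all _ fun x => mul_nonneg zero_le_two (frob2_nonneg _))]
        simp_rw [ENNReal.ofReal_mul zero_le_two]
        simp
    _ = 2 * ∫⁻ x, ENNReal.ofReal (frob2 (strain v x)) := lintegral_const_mul' _ _ (by norm_num)
    _ ≤ 2 * ∫⁻ x, Bh.indicator (fun x =>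
      3 * es u x + ∑ i, ∑ j, ‖a i j + a j i‖ₑ^2 + ENNReal.ofReal (9 * M^2) * ∑ i, ‖w x i‖ₑ^2) x := by
        gcongr with x; exact hst x
    _ = 2 * (3 * (∫⁻ x in Bh, es u x) + (∑ i, ∑ j, ‖a i j + a j i‖ₑ^2) * V +
          ENNReal.ofReal (9 * M^2) * ∑ i, ∫⁻ x in Bh, ‖w x i‖ₑ^2) := by
        rw [lintegral_indicator measurableSet_ball, lintegral_add_left (by have := measurable_es u; fun_prop),
          lintegral_add_left (by have := measurable_es u; fun_prop), lintegral_const_mul _ (measurable_es u),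
          lintegral_const_mul' _ _ ENNReal.ofReal_ne_top, lintegral_finsetSum' _ (fun i _ => hwm i)]
        simp [hV]
    _ ≤ 2 * (3 * (∫⁻ x in Bh, es u x) + (∑ i : Fin 3, ∑ j : Fin 3, K * ∫⁻ x in Bh, es u x) * V +
          ENNReal.ofReal (9 * M^2) * ∑ i : Fin 3, K * ∫⁻ x in Bh, es u x) := by
        gcongr with i _ j _ i
        · exact h2 i j
        · exact h1 i
    _ = K1 * ∫⁻ x in Bh, es u x := by
        rw [hK1]; simp only [Finset.sum_const, Finset.card_univ, Fintype.card_fin, nsmul_eq_mul]; push_cast; ring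
    _ ≤ _ := by gcongr


lemma lint_ball (h : E3 → ℝ≥0∞) (x₀ : E3) {ρ : ℝ} (hρ : 0 < ρ) (r : ℝ) :
    ∫⁻ y in ball (0:E3) r, h (x₀ + ρ • y) = ENNReal.ofReal ((ρ^3)⁻¹) * ∫⁻ x in ball x₀ (ρ * r), h x := by
  rw [← lintegral_indicator measurableSet_ball, ← lintegral_indicator measurableSet_ball,
    ← lint_affine _ x₀ hρ]
  congr 1; ext y
  have : y ∈ ball (0:E3) r ↔ x₀ + ρ • y ∈ ball x₀ (ρ * r) := by
    rw [mem_ball_zero_iff, mem_ball_iff_norm, add_sub_cancel_left, norm_smul, Real.norm_of_nonneg hρ.le]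
    exact (mul_lt_mul_iff_right₀ hρ).symm
  by_cases hy : y ∈ ball (0:E3) r
  · rw [indicator_of_mem hy, indicator_of_mem (this.1 hy)]
  · rw [indicator_of_notMem hy, indicator_of_notMem (fun h => hy (this.2 h))]

lemma korn_ball : ∃ K : ℝ≥0, ∀ (Ω : Set E3) (u : E3 → E3), IsOpen Ω → ContDiffOn ℝ 1 u Ω →
    ∀ (x₀ : E3) (ρ : ℝ), 0 < ρ → ball x₀ (2*ρ) ⊆ Ω → ∃ A : E3 →L[ℝ] E3,
    ∫⁻ x in ball x₀ ρ, ‖fderiv ℝ u x - A‖ₑ^2 ≤ K * ∫⁻ x in ball x₀ (2*ρ), es u x := by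
  obtain ⟨K, hK⟩ := korn_unit
  refine ⟨K, fun Ω u hΩ hu x₀ ρ hρ hB => ?_⟩
  have hmap : ∀ y ∈ ball (0:E3) 2, x₀ + ρ • y ∈ Ω := by
    intro y hy
    apply hB
    rw [mem_ball_zero_iff] at hy
    rw [mem_ball_iff_norm, add_sub_cancel_left, norm_smul, Real.norm_of_nonneg hρ.le]
    nlinarith
  let v : E3 → E3 := fun y => ρ⁻¹ • u (x₀ + ρ • y)
  have hv : ContDiffOn ℝ 1 v (ball 0 2) := by
    apply ContDiffOn.const_smul
    exact hu.comp (by fun_prop) hmap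
  have hfd : ∀ y ∈ ball (0:E3) 2, fderiv ℝ v y = fderiv ℝ u (x₀ + ρ • y) := by
    intro y hy
    have h1 : HasFDerivAt u (fderiv ℝ u (x₀ + ρ • y)) (x₀ + ρ • y) :=
      ((hu.contDiffAt (hΩ.mem_nhds (hmap y hy))).differentiableAt one_ne_zero).hasFDerivAt
    have h2 : HasFDerivAt (fun y : E3 => x₀ + ρ • y) (ρ • ContinuousLinearMap.id ℝ E3) y :=
      ((hasFDerivAt_id y).const_smul ρ).const_add x₀
    have := ((h1.comp y h2).const_smul ρ⁻¹).fderiv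
    rw [show fderiv ℝ v y = _ from this]
    ext d : 1
    simp [smul_smul, hρ.ne']
  obtain ⟨A, hA⟩ := hK v hv
  refine ⟨A, ?_⟩
  have hes : ∀ y ∈ ball (0:E3) 2, es v y = es u (x₀ + ρ • y) := by
    intro y hy
    simp only [es, frob2, strain, jac, hfd y hy]
  rw [setLIntegral_congr_fun measurableSet_ball (g := fun y => ‖fderiv ℝ u (x₀ + ρ • y) - A‖ₑ^2)
      (fun y hy => by
        simp only
        rw [hfd y (ball_subset_ball (by norm_num) hy)]),
    setLIntegral_congr_fun measurableSet_ball hes,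
    lint_ball (fun x => ‖fderiv ℝ u x - A‖ₑ^2) x₀ hρ, lint_ball (es u) x₀ hρ, mul_left_comm,
    ENNReal.mul_le_mul_iff_right (by simp; positivity) ENNReal.ofReal_ne_top, mul_one, mul_comm ρ 2] at hA
  exact hA

def BP {V : Type*} [NormedAddCommGroup V] (f : E3 → V) (g : E3 → ℝ≥0∞) (Ω : Set E3) (K R : ℝ≥0∞) : Prop :=
  ∀ x ρ, 0 < ρ → ENNReal.ofReal ρ ≤ R → ball x (2*ρ) ⊆ Ω →
    ∃ c : V, ∫⁻ y in ball x ρ, ‖f y - c‖ₑ^2 ≤ K * ∫⁻ y in ball x (2*ρ), g y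

lemma BP.sub {V : Type*} [NormedAddCommGroup V] {f : E3 → V} {g : E3 → ℝ≥0∞} {Ω : Set E3} {K R : ℝ≥0∞}
    (h : BP f g Ω K R) (c : V) : BP (fun x => f x - c) g Ω K R := by
  intro x ρ h1 h2 h3
  obtain ⟨c', hc⟩ := h x ρ h1 h2 h3
  exact ⟨c' - c, by simpa using hc⟩

/-- structure of a graph-type height function -/
structure HF (s : E3 → ℝ) (n : E3) (L : ℝ) : Prop where
  one_le : 1 ≤ L
  norm_n : ‖n‖ = 1
  lip : ∀ x y, |s x - s y| ≤ L * ‖x - y‖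
  shift : ∀ x t, s (x + t • n) = s x + t

namespace HF
variable {s : E3 → ℝ} {n : E3} {L : ℝ}

lemma lipw (h : HF s n L) : LipschitzWith (Real.toNNReal L) s := by
  apply LipschitzWith.of_dist_le_mul
  intro x y
  rw [Real.coe_toNNReal _ (by linarith [h.one_le]), Real.dist_eq, dist_eq_norm]
  exact h.lip x y

lemma cont (h : HF s n L) : Continuous s := h.lipw.continuous

lemma inj (h : HF s n L) {ε : ℝ} (hε : 0 < ε) : Function.Injective (fun x => x + (ε * s x) • n) := by
  intro x y hxy
  simp only at hxy
  have h1 : x = y + (ε * s y - ε * s x) • n := by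
    rw [sub_smul, ← add_sub_assoc, ← hxy]; simp
  have h2 := h.shift y (ε * s y - ε * s x)
  rw [← h1] at h2
  have h3 : s x = s y := by nlinarith
  rw [h1, h3]; simp

lemma cov (h : HF s n L) {ε : ℝ} (hε : 0 < ε) {E : Set E3} (hE : MeasurableSet E) (F : E3 → ℝ≥0∞) :
    ∫⁻ x in E, F (x + (ε * s x) • n) ≤
      ENNReal.ofReal ((1+ε)⁻¹) * ∫⁻ x in (fun x => x + (ε * s x) • n) '' E, F x := by
  set E' := E ∩ {x | DifferentiableAt ℝ s x} with hE'
  have hE'm : MeasurableSet E' := hE.inter (measurableSet_of_differentiableAt ℝ s)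
  have hae : ∀ᵐ x : E3, DifferentiableAt ℝ s x := h.lipw.ae_differentiableAt
  have e1 : ∫⁻ x in E, F (x + (ε * s x) • n) = ∫⁻ x in E', F (x + (ε * s x) • n) := by
    apply setLIntegral_congr
    filter_upwards [hae] with x hx
    simp only [hE', eq_iff_iff]
    exact ⟨fun h => ⟨h, hx⟩, fun h => h.1⟩
  let τ' : E3 → (E3 →L[ℝ] E3) := fun x => ContinuousLinearMap.id ℝ E3 + (ε • fderiv ℝ s x).smulRight n
  have hd : ∀ x ∈ E', HasFDerivWithinAt (fun x => x + (ε * s x) • n) (τ' x) E' x := by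
    intro x hx
    apply HasFDerivAt.hasFDerivWithinAt
    have := (hasFDerivAt_id (𝕜 := ℝ) x).add ((hx.2.hasFDerivAt.const_mul ε).smul_const n)
    exact this
  have hdet : ∀ x ∈ E', (τ' x).det = 1 + ε := by
    intro x hx
    have hn : fderiv ℝ s x n = 1 := by
      have h1 : HasDerivAt (fun t : ℝ => s (x + t • n)) (fderiv ℝ s x n) 0 := by
        have h0 : HasFDerivAt s (fderiv ℝ s x) (x + (0:ℝ) • n) := by simpa using hx.2.hasFDerivAt
        refine h0.comp_hasDerivAt (0:ℝ) ?_
        simpa using ((hasDerivAt_id (0:ℝ)).smul_const n).const_add x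
      have h2 : HasDerivAt (fun t : ℝ => s (x + t • n)) 1 0 := by
        simp_rw [h.shift]
        exact (hasDerivAt_id (0:ℝ)).const_add (s x)
      exact h1.unique h2
    have : (τ' x : E3 →ₗ[ℝ] E3) = LinearMap.transvection ((ε • fderiv ℝ s x : E3 →L[ℝ] ℝ) : E3 →ₗ[ℝ] ℝ) n := by
      ext d : 1
      simp [τ', LinearMap.transvection]
    rw [ContinuousLinearMap.det, this, LinearMap.transvection.det]
    simp [hn]
  have := lintegral_image_eq_lintegral_abs_det_fderiv_mul volume hE'm hd ((h.inj hε).injOn) F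
  have e2 : ∫⁻ x in E', ENNReal.ofReal |(τ' x).det| * F (x + (ε * s x) • n) =
      ENNReal.ofReal (1+ε) * ∫⁻ x in E', F (x + (ε * s x) • n) := by
    rw [← lintegral_const_mul' _ _ ENNReal.ofReal_ne_top]
    refine setLIntegral_congr_fun hE'm fun x hx => ?_
    rw [hdet x hx, abs_of_pos (by linarith)]
  rw [e2] at this
  rw [e1]
  have hpos : (0:ℝ) < 1 + ε := by linarith
  calc _ = ENNReal.ofReal ((1+ε)⁻¹) * (ENNReal.ofReal (1+ε) * ∫⁻ x in E', F (x + (ε * s x) • n)) := by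
        rw [← mul_assoc, ← ENNReal.ofReal_mul (by positivity), inv_mul_cancel₀ hpos.ne']; simp
    _ ≤ _ := by
        rw [← this]
        gcongr
        exact inter_subset_left
end HF


lemma vol_ball (x : E3) {r : ℝ} (hr : 0 ≤ r) :
    volume (ball x r) = ENNReal.ofReal (r^3) * volume (ball (0:E3) 1) := by
  have := Measure.addHaar_ball (volume : Measure E3) x hr
  rw [this]; simp

def kerS (s : E3 → ℝ) (c : ℝ) (x z : E3) : ℝ≥0∞ :=
  if ‖x - z‖ < c * s z then ENNReal.ofReal ((s z ^ 3)⁻¹) else 0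

lemma measurable_ker {s : E3 → ℝ} (hs : Continuous s) (c : ℝ) :
    Measurable (fun p : E3 × E3 => kerS s c p.1 p.2) := by
  unfold kerS
  apply Measurable.ite
  · apply measurableSet_lt <;> apply Continuous.measurable <;> fun_prop
  · have : Measurable s := hs.measurable
    fun_prop
  · fun_prop

namespace HF
variable {s : E3 → ℝ} {n : E3} {L : ℝ}

lemma near (h : HF s n L) {x z : E3} {c : ℝ} (hz : ‖x - z‖ < c / L * s z) :
    |s x - s z| < c * s z := by
  have hL : 0 < L := by linarith [h.one_le]
  refine (h.lip x z).trans_lt ?_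
  calc L * ‖x - z‖ < L * (c / L * s z) := by gcongr
    _ = c * s z := by field_simp

lemma ker_low (h : HF s n L) {x : E3} (hx : 0 < s x) :
    ENNReal.ofReal ((1/(8*L))^3/64) * volume (ball (0:E3) 1) ≤ ∫⁻ z, kerS s (1/(8*L)) x z := by
  have hL : 0 < L := by linarith [h.one_le]
  set κ := 1/(8*L) with hκ
  have hκ0 : 0 < κ := by positivity
  calc _ = ∫⁻ z in ball x (κ * s x/2), ENNReal.ofReal (((2 * s x)^3)⁻¹) := by
        rw [setLIntegral_const, vol_ball x (by positivity), ← mul_assoc, ← ENNReal.ofReal_mul (by positivity)]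
        congr 2
        field_simp
        norm_num
    _ ≤ ∫⁻ z in ball x (κ * s x/2), kerS s κ x z := by
        refine setLIntegral_mono' measurableSet_ball fun z hz => ?_
        rw [mem_ball_iff_norm] at hz
        have h1 : |s z - s x| < (1/16) * s x := by
          apply h.near
          refine hz.trans_eq ?_
          rw [hκ]; field_simp; norm_num
        have h2 := abs_lt.1 h1
        have : ‖x - z‖ < κ * s z := by
          rw [norm_sub_rev]
          refine hz.trans ?_
          have : s x /2 < s z := by linarith
          calc κ * s x / 2 = κ * (s x / 2) := by ring
            _ < _ := by gcongr
        rw [kerS, if_pos this]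
        apply ENNReal.ofReal_le_ofReal
        have hz0 : 0 < s z := by linarith
        gcongr
        linarith
    _ ≤ _ := setLIntegral_le_lintegral _ _

lemma ker_high (h : HF s n L) (y : E3) :
    ∫⁻ z, kerS s (4*(1/(8*L))) y z ≤ ENNReal.ofReal (1728 * (1/(8*L))^3) * volume (ball (0:E3) 1) := by
  have hL : 0 < L := by linarith [h.one_le]
  set κ := 1/(8*L) with hκ
  have hκ0 : 0 < κ := by positivity
  have key : ∀ z, ‖y - z‖ < 4 * κ * s z → 0 < s z ∧ 2/3 * s y < s z ∧ s z < 2 * s y := by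
    intro z hz
    have h0 : 0 < s z := by
      by_contra hc
      have := norm_nonneg (y - z)
      nlinarith
    have := abs_lt.1 (h.near (c := 1/2) (x := y) (z := z) (by
      refine hz.trans_eq ?_
      rw [hκ]; field_simp; norm_num))
    refine ⟨h0, by linarith, by linarith⟩
  by_cases hy : 0 < s y
  · calc _ ≤ ∫⁻ z, (ball y (8 * κ * s y)).indicator (fun _ => ENNReal.ofReal (((2/3 * s y)^3)⁻¹)) z := by
          refine lintegral_mono fun z => ?_
          by_cases hz : ‖y - z‖ < 4 * κ * s z
          · obtain ⟨a, b, c⟩ := key z hz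
            rw [kerS, if_pos hz, indicator_of_mem]
            · apply ENNReal.ofReal_le_ofReal
              gcongr
            · rw [mem_ball_iff_norm, norm_sub_rev]
              refine hz.trans ?_
              have := mul_lt_mul_of_pos_left c hκ0
              linarith
          · rw [kerS, if_neg hz]; exact bot_le
      _ = _ := by
          rw [lintegral_indicator measurableSet_ball, setLIntegral_const, vol_ball _ (by positivity), ← mul_assoc, ← ENNReal.ofReal_mul (by positivity)]
          congr 2
          field_simp
          norm_num
  · have : ∀ z, kerS s (4*κ) y z = 0 := by
      intro z
      rw [kerS, if_neg]
      intro hz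
      obtain ⟨a, b, c⟩ := key z hz
      linarith
    simp [this]

lemma diff_bound (h : HF s n L) {V : Type*} [NormedAddCommGroup V] {f : E3 → V} {g : E3 → ℝ≥0∞}
    {Ω D : Set E3} {K R : ℝ≥0∞} (hBP : BP f g Ω K R) (hf : StronglyMeasurable f) (hg : Measurable g)
    (hK : K ≠ ∞) {ε : ℝ} (hε : 0 < ε) (hεL : ε ≤ 1/(16*L)) (hD : MeasurableSet D)
    (hDs : ∀ x ∈ D, 0 < s x ∧ ball x (s x / L) ⊆ Ω ∧ ENNReal.ofReal (s x / L) ≤ R) :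
    ∫⁻ x in D, ‖f x - f (x + (ε * s x) • n)‖ₑ^2 ≤ 442368 * K * ∫⁻ x in Ω, g x := by
  have hL : 0 < L := by linarith [h.one_le]
  have hs := h.cont
  set κ := 1/(8*L) with hκ
  have hκ0 : 0 < κ := by positivity
  have hεκ : ε ≤ κ / 2 := hεL.trans_eq (by rw [hκ]; field_simp; norm_num)
  set b := volume (ball (0:E3) 1) with hb
  have hbt : b ≠ ∞ := measure_ball_lt_top.ne
  have hb0 : b ≠ 0 := (measure_ball_pos _ _ one_pos).ne'
  set F : E3 → ℝ≥0∞ := fun x => ‖f x - f (x + (ε * s x) • n)‖ₑ^2 with hF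
  have hτ : Measurable fun x : E3 => x + (ε * s x) • n := by
    apply Continuous.measurable; fun_prop
  have hFm : Measurable F := by
    have : StronglyMeasurable (fun x => f x - f (x + (ε * s x) • n)) := hf.sub (hf.comp_measurable hτ)
    exact this.enorm.pow_const 2
  have hkm := measurable_ker hs κ
  have hkm4 := measurable_ker hs (4*κ)
  have inner : ∀ z, ∫⁻ x in D, kerS s κ x z * F x ≤ 4 * K * ∫⁻ y in Ω, kerS s (4*κ) y z * g y := by
    intro z
    by_cases hz : ∃ x ∈ D, ‖x - z‖ < κ * s z
    swap
    · have : ∫⁻ x in D, kerS s κ x z * F x = ∫⁻ x in D, 0 := by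
        refine setLIntegral_congr_fun hD fun x hx => ?_
        have : ¬ ‖x - z‖ < κ * s z := fun hc => hz ⟨x, hx, hc⟩
        simp [kerS, this]
      rw [this]; simp
    obtain ⟨x₀, hx₀, hxz⟩ := hz
    obtain ⟨hp, hball, hR⟩ := hDs x₀ hx₀
    have hz0 : 0 < s z := by
      by_contra hc
      have := norm_nonneg (x₀ - z)
      nlinarith
    have hsx : ∀ x, ‖x - z‖ < κ * s z → |s x - s z| < 1/8 * s z := by
      intro x hx
      apply h.near
      refine hx.trans_eq ?_
      rw [hκ]; field_simp
    have h0 := abs_lt.1 (hsx x₀ hxz)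
    have hsubB : ball z (2 * (2 * κ * s z)) ⊆ Ω := by
      refine Subset.trans ?_ hball
      apply ball_subset_ball'
      rw [dist_comm, dist_eq_norm]
      have e : s x₀ / L = 8 * κ * s x₀ := by rw [hκ]; field_simp
      rw [e]
      have : κ * (7/8 * s z) ≤ κ * s x₀ := by gcongr; linarith
      nlinarith
    obtain ⟨c, hc⟩ := hBP z (2 * κ * s z) (by positivity) (by
      refine le_trans (ENNReal.ofReal_le_ofReal ?_) hR
      have e : s x₀ / L = 8 * κ * s x₀ := by rw [hκ]; field_simp
      rw [e]
      have : κ * (7/8 * s z) ≤ κ * s x₀ := by gcongr; linarith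
      nlinarith) hsubB
    set q := ENNReal.ofReal ((s z ^ 3)⁻¹) with hq
    have hqt : q ≠ ∞ := ENNReal.ofReal_ne_top
    have hcm : Measurable fun x => ‖f x - c‖ₑ^2 := (hf.sub stronglyMeasurable_const).enorm.pow_const 2
    set E := D ∩ ball z (κ * s z) with hE
    have hEm : MeasurableSet E := hD.inter measurableSet_ball
    have b1 : ∫⁻ x in E, ‖f x - c‖ₑ^2 ≤ ∫⁻ y in ball z (2 * κ * s z), ‖f y - c‖ₑ^2 := by
      apply lintegral_mono_set
      refine inter_subset_right.trans (ball_subset_ball ?_)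
      nlinarith
    have b2 : ∫⁻ x in E, ‖f (x + (ε * s x) • n) - c‖ₑ^2 ≤ ∫⁻ y in ball z (2 * κ * s z), ‖f y - c‖ₑ^2 := by
      refine (h.cov hε hEm (fun x => ‖f x - c‖ₑ^2)).trans ?_
      calc _ ≤ 1 * ∫⁻ y in ball z (2 * κ * s z), ‖f y - c‖ₑ^2 := by
            gcongr
            · rw [ENNReal.ofReal_le_one]
              apply inv_le_one_of_one_le₀; linarith
            · rintro _ ⟨x, hx, rfl⟩
              have h1 := mem_ball_iff_norm.1 hx.2
              have h2 := abs_lt.1 (hsx x h1)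
              rw [mem_ball_iff_norm]
              have h3 : 0 < s x := by linarith
              calc ‖x + (ε * s x) • n - z‖ = ‖(x - z) + (ε * s x) • n‖ := by congr 1; abel
                _ ≤ ‖x - z‖ + ε * s x := by
                    refine (norm_add_le _ _).trans_eq ?_
                    rw [norm_smul, h.norm_n, Real.norm_of_nonneg (by positivity), mul_one]
                _ < κ * s z + κ/2 * (9/8 * s z) := by
                    refine add_lt_add_of_lt_of_le h1 ?_
                    gcongr
                    linarith
                _ ≤ 2 * κ * s z := by nlinarith [mul_pos hκ0 hz0]
        _ = _ := one_mul _
    have b3 : ∫⁻ x in E, F x ≤ 4 * ∫⁻ y in ball z (2 * κ * s z), ‖f y - c‖ₑ^2 := by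
      calc _ ≤ ∫⁻ x in E, (2 * ‖f x - c‖ₑ^2 + 2 * ‖f (x + (ε * s x) • n) - c‖ₑ^2) := by
            refine lintegral_mono fun x => ?_
            have := sq_add_le_enorm (f x - c) (c - f (x + (ε * s x) • n))
            rw [sub_add_sub_cancel] at this
            refine this.trans_eq ?_
            rw [← enorm_neg (c - _), neg_sub]
        _ = 2 * (∫⁻ x in E, ‖f x - c‖ₑ^2) + 2 * ∫⁻ x in E, ‖f (x + (ε * s x) • n) - c‖ₑ^2 := by
            rw [lintegral_add_left (by fun_prop), lintegral_const_mul' _ _ (by norm_num),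
              lintegral_const_mul' _ _ (by norm_num)]
        _ ≤ 2 * (∫⁻ y in ball z (2 * κ * s z), ‖f y - c‖ₑ^2) + 2 * (∫⁻ y in ball z (2 * κ * s z), ‖f y - c‖ₑ^2) := by
            gcongr
        _ = _ := by ring
    calc ∫⁻ x in D, kerS s κ x z * F x ≤ ∫⁻ x in D, (ball z (κ * s z)).indicator (fun x => q * F x) x := by
          refine lintegral_mono fun x => ?_
          by_cases hx : ‖x - z‖ < κ * s z
          · rw [indicator_of_mem (mem_ball_iff_norm.2 hx), kerS, if_pos hx]
          · simp [kerS, hx]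
      _ = q * ∫⁻ x in E, F x := by
          rw [lintegral_indicator measurableSet_ball, Measure.restrict_restrict measurableSet_ball,
            lintegral_const_mul' _ _ hqt, inter_comm]
      _ ≤ q * (4 * (K * ∫⁻ y in ball z (2 * (2 * κ * s z)), g y)) := by
          gcongr; exact b3.trans (by gcongr)
      _ = 4 * K * ∫⁻ y in ball z (2 * (2 * κ * s z)), q * g y := by
          rw [lintegral_const_mul' _ _ hqt]; ring
      _ = 4 * K * ∫⁻ y in ball z (2 * (2 * κ * s z)), kerS s (4*κ) y z * g y := by
          congr 1
          refine setLIntegral_congr_fun measurableSet_ball fun y hy => ?_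
          have : ‖y - z‖ < 4 * κ * s z := by
            have := mem_ball_iff_norm.1 hy; linarith
          simp [kerS, this, hq]
      _ ≤ _ := by gcongr
  set m := ENNReal.ofReal (κ^3/64) * b with hm
  have hm0 : m ≠ 0 := by
    rw [hm]
    refine mul_ne_zero ?_ hb0
    simp; positivity
  have hmt : m ≠ ∞ := by rw [hm]; finiteness
  rw [← ENNReal.mul_le_mul_iff_right hm0 hmt]
  calc m * ∫⁻ x in D, F x = ∫⁻ x in D, m * F x := by rw [lintegral_const_mul' _ _ hmt]
    _ ≤ ∫⁻ x in D, ∫⁻ z, kerS s κ x z * F x := by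
        refine setLIntegral_mono' hD fun x hx => ?_
        rw [lintegral_mul_const _ (by fun_prop)]
        gcongr
        exact h.ker_low (hDs x hx).1
    _ = ∫⁻ z, ∫⁻ x in D, kerS s κ x z * F x := by
        rw [lintegral_lintegral_swap]
        apply Measurable.aemeasurable
        show Measurable fun p : E3 × E3 => kerS s κ p.1 p.2 * F p.1
        fun_prop
    _ ≤ ∫⁻ z, 4 * K * ∫⁻ y in Ω, kerS s (4*κ) y z * g y := lintegral_mono inner
    _ = 4 * K * ∫⁻ z, ∫⁻ y in Ω, kerS s (4*κ) y z * g y := by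
        rw [lintegral_const_mul' _ _ (by finiteness)]
    _ = 4 * K * ∫⁻ y in Ω, ∫⁻ z, kerS s (4*κ) y z * g y := by
        rw [lintegral_lintegral_swap]
        apply Measurable.aemeasurable
        show Measurable fun p : E3 × E3 => kerS s (4*κ) p.2 p.1 * g p.2
        exact (hkm4.comp measurable_swap).mul (by fun_prop)
    _ ≤ 4 * K * ∫⁻ y in Ω, (ENNReal.ofReal (1728 * κ^3) * b) * g y := by
        gcongr with y
        rw [lintegral_mul_const _ (by fun_prop)]
        gcongr
        exact h.ker_high y
    _ = 4 * K * ((ENNReal.ofReal (1728 * κ^3) * b) * ∫⁻ y in Ω, g y) := by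
        rw [lintegral_const_mul' _ _ (by finiteness)]
    _ = _ := by
        have : ENNReal.ofReal (1728 * κ^3) = 110592 * ENNReal.ofReal (κ^3/64) := by
          rw [show (110592:ℝ≥0∞) = ENNReal.ofReal 110592 by norm_num, ← ENNReal.ofReal_mul (by norm_num)]
          congr 1; ring
        rw [this, hm]; ring

lemma stretch (h : HF s n L) {V : Type*} [NormedAddCommGroup V] {f : E3 → V} {g : E3 → ℝ≥0∞}
    {Ω D Y : Set E3} {K R : ℝ≥0∞} (hBP : BP f g Ω K R) (hf : StronglyMeasurable f) (hg : Measurable g)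
    (hK : K ≠ ∞) {ε : ℝ} (hε : 0 < ε) (hεL : ε ≤ 1/(16*L)) (hD : MeasurableSet D)
    (hDs : ∀ x ∈ D, 0 < s x ∧ ball x (s x / L) ⊆ Ω ∧ ENNReal.ofReal (s x / L) ≤ R)
    (hτ : ∀ x ∈ D, x + (ε * s x) • n ∈ D ∪ Y) (hfin : ∫⁻ x in D, ‖f x‖ₑ^2 ≠ ∞) :
    ∫⁻ x in D, ‖f x‖ₑ^2 ≤ ENNReal.ofReal (442368 * (2*(1+ε)/ε) * (1 + 2/ε)) *
      ((∫⁻ x in Y, ‖f x‖ₑ^2) + K * ∫⁻ x in Ω, g x) := by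
  set X := ∫⁻ x in D, ‖f x‖ₑ^2 with hX
  set y := ∫⁻ x in Y, ‖f x‖ₑ^2
  set G := K * ∫⁻ x in Ω, g x with hG
  have hdb := h.diff_bound hBP hf hg hK hε hεL hD hDs
  have hτm : Measurable fun x : E3 => x + (ε * s x) • n := by
    have := h.cont
    apply Continuous.measurable; fun_prop
  by_cases hfin2 : y + G = ∞
  · rw [hfin2, ENNReal.mul_top]
    · exact le_top
    · simp; positivity
  have hyt : y ≠ ∞ := fun hh => hfin2 (by simp [hh])
  have hGt : G ≠ ∞ := fun hh => hfin2 (by simp [hh])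
  have pw : ∀ a b : V, ‖a‖ₑ^2 ≤ ENNReal.ofReal (1+ε/2) * ‖b‖ₑ^2 + ENNReal.ofReal (1 + 2/ε) * ‖a - b‖ₑ^2 := by
    intro a b
    rw [enorm_sq_eq, enorm_sq_eq, enorm_sq_eq, ← ENNReal.ofReal_mul (by positivity),
      ← ENNReal.ofReal_mul (by positivity), ← ENNReal.ofReal_add (by positivity) (by positivity)]
    apply ENNReal.ofReal_le_ofReal
    have h1 : ‖a‖ ≤ ‖b‖ + ‖a - b‖ := by
      have := norm_add_le b (a - b); rwa [add_sub_cancel] at this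
    set p := ‖b‖
    set q := ‖a - b‖
    have h2 : ‖a‖^2 ≤ (p+q)^2 := by gcongr
    have h3 : (p+q)^2 ≤ (1+ε/2)*p^2 + (1+2/ε)*q^2 := by
      have : (1+ε/2)*p^2 + (1+2/ε)*q^2 - (p+q)^2 = (ε*p - 2*q)^2/(2*ε) := by field_simp; ring
      have h4 : 0 ≤ (ε*p - 2*q)^2/(2*ε) := by positivity
      linarith
    linarith
  have hmain : X ≤ ENNReal.ofReal ((1+ε/2)/(1+ε)) * (X + y) + ENNReal.ofReal (1 + 2/ε) * (442368 * G) := by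
    calc X ≤ ∫⁻ x in D, (ENNReal.ofReal (1+ε/2) * ‖f (x + (ε * s x) • n)‖ₑ^2 +
          ENNReal.ofReal (1 + 2/ε) * ‖f x - f (x + (ε * s x) • n)‖ₑ^2) := lintegral_mono fun x => pw _ _
      _ = ENNReal.ofReal (1+ε/2) * (∫⁻ x in D, ‖f (x + (ε * s x) • n)‖ₑ^2) +
          ENNReal.ofReal (1 + 2/ε) * ∫⁻ x in D, ‖f x - f (x + (ε * s x) • n)‖ₑ^2 := by
          have := (hf.comp_measurable hτm).enorm
          rw [lintegral_add_left (by simp only [Function.comp_apply] at this; fun_prop), lintegral_const_mul' _ _ ENNReal.ofReal_ne_top,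
            lintegral_const_mul' _ _ ENNReal.ofReal_ne_top]
      _ ≤ ENNReal.ofReal (1+ε/2) * (ENNReal.ofReal ((1+ε)⁻¹) * (X + y)) +
          ENNReal.ofReal (1 + 2/ε) * (442368 * G) := by
          gcongr
          · refine (h.cov hε hD (fun x => ‖f x‖ₑ^2)).trans ?_
            gcongr
            calc _ ≤ ∫⁻ x in D ∪ Y, ‖f x‖ₑ^2 := by
                  apply lintegral_mono_set
                  rintro _ ⟨x, hx, rfl⟩
                  exact hτ x hx
              _ ≤ _ := lintegral_union_le _ _ _
          · rw [hG, ← mul_assoc]; exact hdb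
      _ = _ := by
          rw [← mul_assoc, ← ENNReal.ofReal_mul (by positivity), ← div_eq_mul_inv]
  clear_value X y G
  lift X to ℝ≥0 using hfin
  lift y to ℝ≥0 using hyt
  lift G to ℝ≥0 using hGt
  have e1 : ENNReal.ofReal ((1+ε/2)/(1+ε)) = ((Real.toNNReal ((1+ε/2)/(1+ε)) : ℝ≥0) : ℝ≥0∞) := rfl
  have e2 : ENNReal.ofReal (1+2/ε) = ((Real.toNNReal (1+2/ε) : ℝ≥0) : ℝ≥0∞) := rfl
  have e3 : ENNReal.ofReal (442368 * (2*(1+ε)/ε) * (1 + 2/ε)) = ((Real.toNNReal (442368 * (2*(1+ε)/ε) * (1 + 2/ε)) : ℝ≥0) : ℝ≥0∞) := rfl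
  rw [e1, e2] at hmain
  rw [e3]
  norm_cast at hmain ⊢
  rw [← NNReal.coe_le_coe] at hmain ⊢
  push_cast at hmain ⊢
  rw [Real.coe_toNNReal _ (by positivity), Real.coe_toNNReal _ (by positivity)] at hmain
  rw [Real.coe_toNNReal _ (by positivity)]
  have hy0 : 0 ≤ (y:ℝ) := y.2
  have hG0 : 0 ≤ (G:ℝ) := G.2
  have e4 : (X:ℝ) * ((ε/2)/(1+ε)) ≤ (y:ℝ) + (1+2/ε) * (442368 * G) := by
    have : (1+ε/2)/(1+ε) = 1 - (ε/2)/(1+ε) := by field_simp; ring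
    have h5 : (0:ℝ) ≤ (ε/2)/(1+ε) := by positivity
    rw [this] at hmain
    nlinarith
  have e5 : (X:ℝ) ≤ (2*(1+ε)/ε) * ((y:ℝ) + (1+2/ε) * (442368 * G)) := by
    calc (X:ℝ) = (2*(1+ε)/ε) * (X * ((ε/2)/(1+ε))) := by field_simp
      _ ≤ _ := by gcongr
  refine e5.trans ?_
  have h6 : (1:ℝ) ≤ 1 + 2/ε := by have : 0 < 2/ε := by positivity
                                  linarith
  have h7 : (y:ℝ) + (1+2/ε) * (442368 * G) ≤ 442368 * (1+2/ε) * (y + G) := by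
    nlinarith
  calc _ ≤ (2*(1+ε)/ε) * (442368 * (1+2/ε) * ((y:ℝ) + G)) := by gcongr
    _ = _ := by ring
end HF


def Chart (Ω : Set E3) (P : E3) (L r₁ : ℝ) : Prop :=
  ∃ s n, HF s n L ∧ s P = 0 ∧ ∀ x ∈ ball P r₁, x ∈ Ω ↔ 0 < s x

def CK (L : ℝ) : ℝ≥0∞ :=
  ENNReal.ofReal (442368 * (2*(1+1/(16*L))/(1/(16*L))) * (1 + 2/(1/(16*L)))) * 2 + 1

lemma CK_ne (L : ℝ) : CK L ≠ ∞ := by unfold CK; finiteness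

lemma sub_const_le {V : Type} [NormedAddCommGroup V] {f : E3 → V} (hf : StronglyMeasurable f)
    (c : V) (S : Set E3) : ∫⁻ x in S, ‖f x‖ₑ^2 ≤ 2 * (∫⁻ x in S, ‖f x - c‖ₑ^2) + 2 * (‖c‖ₑ^2 * volume S) := by
  calc _ ≤ ∫⁻ x in S, (2 * ‖f x - c‖ₑ^2 + 2 * ‖c‖ₑ^2) := by
        refine lintegral_mono fun x => ?_
        have := sq_add_le_enorm (f x - c) c
        rwa [sub_add_cancel] at this
    _ = _ := by
        have := (hf.sub (stronglyMeasurable_const (b := c))).enorm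
        simp only [Pi.sub_apply] at this
        rw [lintegral_add_right _ (by fun_prop), lintegral_const_mul' _ _ (by norm_num), lintegral_const,
          Measure.restrict_apply_univ, mul_assoc]

lemma piece {Ω : Set E3} {P : E3} {L r₁ : ℝ} (hr : 0 < r₁) (hch : Chart Ω P L r₁)
    {V : Type} [NormedAddCommGroup V] {f : E3 → V} {g : E3 → ℝ≥0∞} {K R : ℝ≥0∞}
    (hBP : BP f g Ω K R) (hR : ENNReal.ofReal r₁ ≤ R) (hf : StronglyMeasurable f) (hg : Measurable g)
    (hK : K ≠ ∞) (hfin : ∫⁻ x in Ω ∩ ball P r₁, ‖f x‖ₑ^2 ≠ ∞) :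
    ∃ c : V, ∫⁻ x in Ω ∩ ball P (r₁/(64*L^2)), ‖f x - c‖ₑ^2 ≤ CK L * (K * ∫⁻ x in Ω, g x) := by
  obtain ⟨s, n, h, hsP, hΩ⟩ := hch
  have hL1 := h.one_le
  have hL : 0 < L := by linarith
  have hs := h.cont
  set a := r₁/4 with ha
  have ha0 : 0 < a := by positivity
  have haL : a / L ≤ a := div_le_self ha0.le hL1
  have haL0 : 0 < a / L := by positivity
  set Q := P + a • n with hQ
  have hsQ : s Q = a := by rw [hQ, h.shift, hsP, zero_add]
  have hBQ : ball Q (2*(a/L/4)) ⊆ Ω := by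
    intro y hy
    rw [mem_ball_iff_norm] at hy
    have hyP : y ∈ ball P r₁ := by
      rw [mem_ball_iff_norm]
      calc ‖y - P‖ = ‖(y - Q) + a • n‖ := by rw [hQ]; congr 1; abel
        _ ≤ ‖y - Q‖ + a := by
            refine (norm_add_le _ _).trans_eq ?_
            rw [norm_smul, h.norm_n, Real.norm_of_nonneg ha0.le, mul_one]
        _ < r₁ := by linarith
    rw [hΩ y hyP]
    have := abs_le.1 (h.lip y Q)
    have h2 : L * ‖y - Q‖ < L * (2*(a/L/4)) := by gcongr
    have h3 : L * (2*(a/L/4)) = a/2 := by field_simp; norm_num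
    linarith
  obtain ⟨c, hc⟩ := hBP Q (a/L/4) (by positivity)
    ((ENNReal.ofReal_le_ofReal (by linarith)).trans hR) hBQ
  refine ⟨c, ?_⟩
  set G := K * ∫⁻ x in Ω, g x with hG
  have hc' : ∫⁻ y in ball Q (a/L/4), ‖f y - c‖ₑ^2 ≤ G := hc.trans (by rw [hG]; gcongr)
  set D : Set E3 := {x | 0 < s x ∧ s x < a ∧ ‖x - s x • n - P‖ < a/L/8} with hD
  have hDm : MeasurableSet D := by
    apply IsOpen.measurableSet
    have o1 : IsOpen {x : E3 | 0 < s x} := isOpen_lt (by fun_prop) (by fun_prop)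
    have o2 : IsOpen {x : E3 | s x < a} := isOpen_lt (by fun_prop) (by fun_prop)
    have o3 : IsOpen {x : E3 | ‖x - s x • n - P‖ < a/L/8} := isOpen_lt (by fun_prop) (by fun_prop)
    exact o1.inter (o2.inter o3)
  have hDP : ∀ x ∈ D, ‖x - P‖ < a/L/8 + s x := by
    rintro x ⟨h1, h2, h3⟩
    calc ‖x - P‖ = ‖(x - s x • n - P) + s x • n‖ := by congr 1; abel
      _ ≤ ‖x - s x • n - P‖ + s x := by
          refine (norm_add_le _ _).trans_eq ?_
          rw [norm_smul, h.norm_n, Real.norm_of_nonneg h1.le, mul_one]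
      _ < _ := by linarith
  have hDΩ : D ⊆ Ω ∩ ball P r₁ := by
    intro x hx
    have h1 := hDP x hx
    have : x ∈ ball P r₁ := by rw [mem_ball_iff_norm]; linarith [hx.2.1]
    exact ⟨(hΩ x this).2 hx.1, this⟩
  have hst := h.stretch (Y := ball Q (a/L/4)) (hBP.sub c) (hf.sub stronglyMeasurable_const) hg hK
    (ε := 1/(16*L)) (by positivity) le_rfl hDm
    (by
      rintro x hx
      have h1 := hDP x hx
      obtain ⟨h2, h3, h4⟩ := hx
      have h5 : s x / L ≤ s x := div_le_self h2.le hL1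
      refine ⟨h2, ?_, (ENNReal.ofReal_le_ofReal (by linarith)).trans hR⟩
      intro y hy
      rw [mem_ball_iff_norm] at hy
      have hyP : y ∈ ball P r₁ := by
        rw [mem_ball_iff_norm]
        have := norm_add_le (y - x) (x - P)
        rw [sub_add_sub_cancel] at this
        linarith
      rw [hΩ y hyP]
      have := abs_le.1 (h.lip y x)
      have h6 : L * ‖y - x‖ < L * (s x / L) := by gcongr
      have h7 : L * (s x / L) = s x := by field_simp
      linarith)
    (by
      rintro x ⟨h2, h3, h4⟩
      have e1 : s (x + (1/(16*L) * s x) • n) = s x + 1/(16*L) * s x := h.shift _ _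
      have e2 : x + (1/(16*L) * s x) • n - (s x + 1/(16*L) * s x) • n - P = x - s x • n - P := by
        rw [add_smul]; abel
      have h5 : 0 < 1/(16*L) * s x := by positivity
      by_cases h6 : s x + 1/(16*L) * s x < a
      · left
        refine ⟨by rw [e1]; linarith, by rw [e1]; exact h6, by rw [e1, e2]; exact h4⟩
      · right
        rw [mem_ball_iff_norm]
        have h7 : 1/(16*L) * s x ≤ a/L/16 := by
          calc 1/(16*L) * s x ≤ 1/(16*L) * a := by gcongr
            _ = _ := by field_simp
        calc ‖x + (1/(16*L) * s x) • n - Q‖ = ‖(x - s x • n - P) + (s x + 1/(16*L) * s x - a) • n‖ := by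
              congr 1; rw [hQ]; module
          _ ≤ ‖x - s x • n - P‖ + (s x + 1/(16*L) * s x - a) := by
              refine (norm_add_le _ _).trans_eq ?_
              rw [norm_smul, h.norm_n, Real.norm_of_nonneg (by linarith), mul_one]
          _ < a/L/4 := by linarith)
    (by
      have h1 := sub_const_le (hf.sub (stronglyMeasurable_const (b := c))) (-c) D
      simp only [Pi.sub_apply, sub_neg_eq_add, sub_add_cancel, enorm_neg] at h1
      refine ne_top_of_le_ne_top ?_ h1
      have h2 : ∫⁻ x in D, ‖f x‖ₑ^2 ≠ ∞ := ne_top_of_le_ne_top hfin (lintegral_mono_set hDΩ)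
      have h3 : volume D ≠ ∞ := ne_top_of_le_ne_top (measure_ball_lt_top (x := P) (r := r₁)).ne
        (measure_mono (hDΩ.trans inter_subset_right))
      finiteness)
  calc ∫⁻ x in Ω ∩ ball P (r₁/(64*L^2)), ‖f x - c‖ₑ^2 ≤ ∫⁻ x in D, ‖f x - c‖ₑ^2 := by
        apply lintegral_mono_set
        rintro x ⟨hx, hxP⟩
        rw [mem_ball_iff_norm] at hxP
        have e0 : r₁/(64*L^2) = a/L/16/L := by rw [ha]; field_simp; norm_num
        rw [e0] at hxP
        have e1 : a/L/16/L ≤ a/L/16 := div_le_self (by positivity) hL1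
        have hx0 := (hΩ x (by rw [mem_ball_iff_norm]; linarith)).1 hx
        have h1 := abs_le.1 (h.lip x P)
        rw [hsP] at h1
        have h2 : L * ‖x - P‖ < L * (a/L/16/L) := by gcongr
        have h3 : L * (a/L/16/L) = a/L/16 := by field_simp
        refine ⟨hx0, by linarith, ?_⟩
        calc ‖x - s x • n - P‖ = ‖(x - P) - s x • n‖ := by congr 1; abel
          _ ≤ ‖x - P‖ + s x := by
              refine (norm_sub_le _ _).trans_eq ?_
              rw [norm_smul, h.norm_n, Real.norm_of_nonneg hx0.le, mul_one]
          _ < _ := by linarith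
    _ ≤ _ := hst
    _ ≤ _ * (G + G) := by gcongr
    _ = _ * 2 * G := by ring
    _ ≤ CK L * G := by unfold CK; gcongr; exact le_self_add

lemma front_near {Ω : Set E3} {q : E3} {d : ℝ} (hq : q ∈ Ω) (h : ¬ ball q d ⊆ Ω) :
    ∃ P ∈ frontier Ω, dist q P < d := by
  obtain ⟨y, hy, hyΩ⟩ := not_subset.1 h
  have hne : Ω ≠ univ := fun hh => hyΩ (hh ▸ mem_univ y)
  obtain ⟨P, hP, hPd⟩ := exists_mem_frontier_infDist_compl_eq_dist hq hne
  refine ⟨P, hP, ?_⟩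
  rw [← hPd]
  exact (infDist_le_dist_of_mem (show y ∈ Ωᶜ from hyΩ)).trans_lt (by rw [dist_comm]; exact hy)

/-- working radius -/
def wr (L r₁ : ℝ) : ℝ := r₁/(64*L^2)/3

lemma loc {Ω : Set E3} {L r₁ : ℝ} (hL : 1 ≤ L) (hr : 0 < r₁) (hch : ∀ P ∈ frontier Ω, Chart Ω P L r₁)
    {V : Type} [NormedAddCommGroup V] {f : E3 → V} {g : E3 → ℝ≥0∞} {K R : ℝ≥0∞}
    (hBP : BP f g Ω K R) (hR : ENNReal.ofReal r₁ ≤ R) (hf : StronglyMeasurable f) (hg : Measurable g)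
    (hK : K ≠ ∞) (hfin : ∀ r, ∫⁻ x in Ω ∩ ball 0 r, ‖f x‖ₑ^2 ≠ ∞) {q : E3} (hq : q ∈ Ω) :
    ∃ c : V, ∫⁻ x in Ω ∩ ball q (wr L r₁), ‖f x - c‖ₑ^2 ≤ CK L * (K * ∫⁻ x in Ω, g x) := by
  have hw0 : 0 < wr L r₁ := by unfold wr; positivity
  have hw1 : wr L r₁ ≤ r₁ := by
    unfold wr
    rw [div_div]
    exact div_le_self hr.le (by nlinarith)
  by_cases hB : ball q (2 * wr L r₁) ⊆ Ω
  · obtain ⟨c, hc⟩ := hBP q (wr L r₁) hw0 ((ENNReal.ofReal_le_ofReal hw1).trans hR) hB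
    refine ⟨c, ?_⟩
    calc _ ≤ ∫⁻ x in ball q (wr L r₁), ‖f x - c‖ₑ^2 := lintegral_mono_set inter_subset_right
      _ ≤ _ := hc
      _ ≤ 1 * (K * ∫⁻ x in Ω, g x) := by rw [one_mul]; gcongr
      _ ≤ _ := by gcongr; unfold CK; exact le_add_self
  · obtain ⟨P, hP, hPq⟩ := front_near hq hB
    obtain ⟨c, hc⟩ := piece hr (hch P hP) hBP hR hf hg hK
      (ne_top_of_le_ne_top (hfin (r₁ + dist P 0)) (lintegral_mono_set
        (inter_subset_inter_right _ (ball_subset_ball' le_rfl))))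
    refine ⟨c, le_trans (lintegral_mono_set (inter_subset_inter_right _ (ball_subset_ball' ?_))) hc⟩
    have : r₁/(64*L^2) = 3 * wr L r₁ := by unfold wr; ring
    rw [this]; linarith

lemma intball {Ω : Set E3} {L r₁ : ℝ} (hL : 1 ≤ L) (hr : 0 < r₁) (hch : ∀ P ∈ frontier Ω, Chart Ω P L r₁)
    {q : E3} (hq : q ∈ Ω) :
    ∃ z, ball z (wr L r₁/(8*L)) ⊆ Ω ∩ ball q (wr L r₁/2) := by
  have hL0 : 0 < L := by linarith
  set w := wr L r₁ with hw
  have hw0 : 0 < w := by rw [hw]; unfold wr; positivity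
  have hw1 : w ≤ r₁ := by
    rw [hw]; unfold wr
    rw [div_div]
    exact div_le_self hr.le (by nlinarith)
  have hwL : w/(8*L) ≤ w/8 := by rw [← div_div]; exact div_le_self (by positivity) hL
  by_cases hB : ball q (w/8) ⊆ Ω
  · exact ⟨q, subset_inter ((ball_subset_ball hwL).trans hB) (ball_subset_ball (by linarith))⟩
  · obtain ⟨P, hP, hPq⟩ := front_near hq hB
    obtain ⟨s, n, h, hsP, hΩ⟩ := hch P hP
    refine ⟨P + (w/4) • n, fun y hy => ?_⟩
    rw [mem_ball_iff_norm] at hy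
    have hyP : ‖y - P‖ < w/4 + w/8 := by
      calc ‖y - P‖ = ‖(y - (P + (w/4) • n)) + (w/4) • n‖ := by congr 1; abel
        _ ≤ ‖y - (P + (w/4) • n)‖ + w/4 := by
            refine (norm_add_le _ _).trans_eq ?_
            rw [norm_smul, h.norm_n, Real.norm_of_nonneg (by positivity), mul_one]
        _ < _ := by linarith
    constructor
    · rw [hΩ y (by rw [mem_ball_iff_norm]; linarith)]
      have h1 := abs_le.1 (h.lip y (P + (w/4) • n))
      rw [h.shift, hsP] at h1
      have h2 : L * ‖y - (P + (w/4) • n)‖ < L * (w/(8*L)) := by gcongr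
      have h3 : L * (w/(8*L)) = w/8 := by field_simp
      linarith
    · rw [mem_ball]
      have := dist_triangle y P q
      rw [dist_comm P q, dist_eq_norm y P] at this
      linarith

lemma step {Ω : Set E3} {L r₁ : ℝ} (hL : 1 ≤ L) (hr : 0 < r₁) (hch : ∀ P ∈ frontier Ω, Chart Ω P L r₁)
    {V : Type} [NormedAddCommGroup V] {f : E3 → V} {g : E3 → ℝ≥0∞} {K R : ℝ≥0∞}
    (hBP : BP f g Ω K R) (hR : ENNReal.ofReal r₁ ≤ R) (hf : StronglyMeasurable f) (hg : Measurable g)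
    (hK : K ≠ ∞) (hfin : ∀ r, ∫⁻ x in Ω ∩ ball 0 r, ‖f x‖ₑ^2 ≠ ∞) {q q' : E3} (hq' : q' ∈ Ω)
    (hd : dist q q' < wr L r₁ / 2) :
    ∫⁻ x in Ω ∩ ball q' (wr L r₁), ‖f x‖ₑ^2 ≤ (4 * ENNReal.ofReal ((8*L)^3) * (1 + CK L) + 2 * CK L) *
      ((∫⁻ x in Ω ∩ ball q (wr L r₁), ‖f x‖ₑ^2) + K * ∫⁻ x in Ω, g x) := by
  have hL0 : 0 < L := by linarith
  obtain ⟨c, hc⟩ := loc hL hr hch hBP hR hf hg hK hfin hq'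
  obtain ⟨z, hz⟩ := intball hL hr hch hq'
  set w := wr L r₁ with hw
  have hw0 : 0 < w := by rw [hw]; unfold wr; positivity
  set G := K * ∫⁻ x in Ω, g x with hG
  set I := ∫⁻ x in Ω ∩ ball q w, ‖f x‖ₑ^2 with hI
  have hz1 : ball z (w/(8*L)) ⊆ Ω ∩ ball q w := hz.trans
    (inter_subset_inter_right _ (ball_subset_ball' (by rw [dist_comm]; linarith)))
  have hz2 : ball z (w/(8*L)) ⊆ Ω ∩ ball q' w := hz.trans
    (inter_subset_inter_right _ (ball_subset_ball (by linarith)))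
  have h1 : ‖c‖ₑ^2 * volume (ball z (w/(8*L))) ≤ 2 * (CK L * G) + 2 * I := by
    calc _ = ∫⁻ x in ball z (w/(8*L)), ‖c‖ₑ^2 := by rw [setLIntegral_const]
      _ ≤ ∫⁻ x in ball z (w/(8*L)), (2 * ‖f x - c‖ₑ^2 + 2 * ‖f x‖ₑ^2) := by
          refine lintegral_mono fun x => ?_
          have := sq_add_le_enorm (c - f x) (f x)
          rw [sub_add_cancel, ← enorm_neg (c - f x), neg_sub] at this
          exact this
      _ = 2 * (∫⁻ x in ball z (w/(8*L)), ‖f x - c‖ₑ^2) + 2 * ∫⁻ x in ball z (w/(8*L)), ‖f x‖ₑ^2 := by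
          have := hf.enorm
          rw [lintegral_add_right _ (by fun_prop), lintegral_const_mul' _ _ (by norm_num),
            lintegral_const_mul' _ _ (by norm_num)]
      _ ≤ _ := by
          gcongr
          · exact (lintegral_mono_set hz2).trans hc
          · exact lintegral_mono_set hz1
  have h2 : volume (Ω ∩ ball q' w) ≤ ENNReal.ofReal ((8*L)^3) * volume (ball z (w/(8*L))) := by
    refine (measure_mono inter_subset_right).trans_eq ?_
    rw [vol_ball _ hw0.le, vol_ball z (by positivity), ← mul_assoc, ← ENNReal.ofReal_mul (by positivity)]
    congr 2; field_simp
  calc _ ≤ _ := sub_const_le hf c _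
    _ ≤ 2 * (CK L * G) + 2 * (‖c‖ₑ^2 * (ENNReal.ofReal ((8*L)^3) * volume (ball z (w/(8*L))))) := by gcongr
    _ = 2 * (CK L * G) + 2 * ENNReal.ofReal ((8*L)^3) * (‖c‖ₑ^2 * volume (ball z (w/(8*L)))) := by ring
    _ ≤ 2 * (CK L * G) + 2 * ENNReal.ofReal ((8*L)^3) * (2 * (CK L * G) + 2 * I) := by gcongr
    _ ≤ 2 * (CK L * (I + G)) + 2 * ENNReal.ofReal ((8*L)^3) * (2 * (CK L * (I + G)) + 2 * (I + G)) := by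
        have e1 : G ≤ I + G := le_add_self
        have e2 : I ≤ I + G := le_self_add
        gcongr
    _ = _ := by ring


def Mseq (K : ℝ≥0∞) : ℕ → ℝ≥0∞
  | 0 => 1
  | k+1 => Mseq K k + K * (Mseq K k + 1)

lemma Mseq_ne {K : ℝ≥0∞} (hK : K ≠ ∞) (k : ℕ) : Mseq K k ≠ ∞ := by
  induction k with
  | zero => simp [Mseq]
  | succ k ih => simp only [Mseq]; finiteness

lemma chain {Ω : Set E3} (hΩ : IsOpen Ω) (hc : IsPreconnected Ω) {R' d : ℝ} (hd : 0 < d) (hd1 : d ≤ 1)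
    (hfar : ∃ q ∈ Ω, R' < ‖q‖) (t : Finset E3) (htR : ∀ z ∈ t, ‖z‖ ≤ R')
    (hcov : closedBall (0:E3) R' ⊆ ⋃ z ∈ t, ball z (d/2)) (I : E3 → ℝ≥0∞) (B G K : ℝ≥0∞)
    (hstep : ∀ q ∈ Ω, ∀ q' ∈ Ω, dist q q' < d → I q' ≤ K * (I q + G))
    (hbase : ∀ q ∈ Ω, R' < ‖q‖ → ‖q‖ < R' + 1 → I q ≤ B) :
    ∀ z ∈ t, ∀ q ∈ Ω ∩ ball z (d/2), I q ≤ Mseq K t.card * (B + G) := by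
  classical
  set S : ℕ → Finset E3 := fun k => t.filter (fun z => ∀ q ∈ Ω ∩ ball z (d/2), I q ≤ Mseq K k * (B + G)) with hS
  have hSt : ∀ k, S k ⊆ t := fun k => Finset.filter_subset _ _
  have hB : ∀ k, B ≤ Mseq K k * (B + G) := by
    intro k
    have : 1 ≤ Mseq K k := by
      induction k with
      | zero => simp [Mseq]
      | succ k ih => exact ih.trans (by simp only [Mseq]; exact le_self_add)
    calc B ≤ 1 * (B + G) := by rw [one_mul]; exact le_self_add
      _ ≤ _ := by gcongr
  have hmono : ∀ k, S k ⊆ S (k+1) := by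
    intro k z hz
    rw [hS, Finset.mem_filter] at hz ⊢
    refine ⟨hz.1, fun q hq => (hz.2 q hq).trans ?_⟩
    gcongr
    simp only [Mseq]; exact le_self_add
  have hgrow : ∀ k, S k ≠ t → (S k).card < (S (k+1)).card := by
    intro k hk
    apply Finset.card_lt_card
    refine (Finset.ssubset_iff_of_subset (hmono k)).2 ?_
    set O : Set E3 := {q | R' < ‖q‖} ∪ ⋃ z ∈ S k, ball z (d/2) with hO
    set O' : Set E3 := ⋃ z ∈ t \ S k, ball z (d/2) with hO'
    have hOo : IsOpen O := (isOpen_lt continuous_const continuous_norm).union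
      (isOpen_biUnion fun _ _ => isOpen_ball)
    have hOo' : IsOpen O' := isOpen_biUnion fun _ _ => isOpen_ball
    have hcover : Ω ⊆ O ∪ O' := by
      intro q _
      by_cases hq : R' < ‖q‖
      · exact Or.inl (Or.inl hq)
      · have := hcov (show q ∈ closedBall (0:E3) R' by rw [mem_closedBall_zero_iff]; linarith)
        rw [mem_iUnion₂] at this
        obtain ⟨z, hz, hqz⟩ := this
        by_cases hzS : z ∈ S k
        · exact Or.inl (Or.inr (mem_iUnion₂.2 ⟨z, hzS, hqz⟩))
        · exact Or.inr (mem_iUnion₂.2 ⟨z, Finset.mem_sdiff.2 ⟨hz, hzS⟩, hqz⟩)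
    have hn1 : (Ω ∩ O).Nonempty := by
      obtain ⟨q, hq, hqR⟩ := hfar
      exact ⟨q, hq, Or.inl hqR⟩
    have hn2 : (Ω ∩ O').Nonempty := by
      obtain ⟨z, hz, hzS⟩ : ∃ z ∈ t, z ∉ S k := by
        by_contra hcon
        push Not at hcon
        exact hk (Finset.Subset.antisymm (hSt k) hcon)
      have : ¬ ∀ q ∈ Ω ∩ ball z (d/2), I q ≤ Mseq K k * (B + G) := fun h =>
        hzS (Finset.mem_filter.2 ⟨hz, h⟩)
      push Not at this
      obtain ⟨q, hq, _⟩ := this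
      exact ⟨q, hq.1, mem_iUnion₂.2 ⟨z, Finset.mem_sdiff.2 ⟨hz, hzS⟩, hq.2⟩⟩
    obtain ⟨q, hqΩ, hqO, hqO'⟩ := hc O O' hOo hOo' hcover hn1 hn2
    obtain ⟨z, hz, hqz⟩ := mem_iUnion₂.1 hqO'
    rw [Finset.mem_sdiff] at hz
    refine ⟨z, ?_, hz.2⟩
    have hIq : I q ≤ Mseq K k * (B + G) := by
      rcases hqO with h | h
      · refine (hbase q hqΩ h ?_).trans (hB k)
        have h1 := mem_ball_iff_norm.1 hqz
        have h2 := norm_add_le (q - z) z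
        rw [sub_add_cancel] at h2
        linarith [htR z hz.1]
      · obtain ⟨z', hz', hq'⟩ := mem_iUnion₂.1 h
        exact (Finset.mem_filter.1 hz').2 q ⟨hqΩ, hq'⟩
    refine Finset.mem_filter.2 ⟨hz.1, fun q' hq' => ?_⟩
    have hdd : dist q q' < d := by
      have := dist_triangle_right q q' z
      have h1 := mem_ball.1 hqz
      have h2 := mem_ball.1 hq'.2
      linarith
    calc I q' ≤ K * (I q + G) := hstep q hqΩ q' hq'.1 hdd
      _ ≤ K * (Mseq K k * (B + G) + (B + G)) := by gcongr; exact le_add_self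
      _ = K * (Mseq K k + 1) * (B + G) := by ring
      _ ≤ _ := by gcongr; simp only [Mseq]; exact le_add_self
  have hcard : ∀ k, k ≤ (S k).card ∨ S k = t := by
    intro k
    induction k with
    | zero => left; exact Nat.zero_le _
    | succ k ih =>
      by_cases hk : S k = t
      · right
        exact Finset.Subset.antisymm (hSt _) (hk ▸ hmono k)
      · left
        have h1 := hgrow k hk
        rcases ih with h | h
        · omega
        · exact absurd h hk
  have hfull : S t.card = t := by
    rcases hcard t.card with h | h
    · exact Finset.eq_of_subset_of_card_le (hSt _) h
    · exact h
  intro z hz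
  rw [← hfull] at hz
  exact (Finset.mem_filter.1 hz).2

theorem bounded_part (L r₁ R' : ℝ) (hL : 1 ≤ L) (hr : 0 < r₁) (hr1 : r₁ ≤ 1) :
    ∃ M : ℝ≥0∞, M ≠ ∞ ∧ ∀ (Ω : Set E3), IsOpen Ω → IsPreconnected Ω → (∃ q ∈ Ω, R' < ‖q‖) →
    (∀ P ∈ frontier Ω, Chart Ω P L r₁) →
    ∀ (V : Type) [NormedAddCommGroup V] (f : E3 → V) (g : E3 → ℝ≥0∞) (K R : ℝ≥0∞),
    BP f g Ω K R → ENNReal.ofReal r₁ ≤ R → StronglyMeasurable f → Measurable g → K ≠ ∞ →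
    (∀ r, ∫⁻ x in Ω ∩ ball 0 r, ‖f x‖ₑ^2 ≠ ∞) →
    ∫⁻ x in Ω ∩ closedBall 0 R', ‖f x‖ₑ^2 ≤
      M * ((∫⁻ x in Ω ∩ {x | R' - 1 < ‖x‖ ∧ ‖x‖ < R' + 2}, ‖f x‖ₑ^2) + K * ∫⁻ x in Ω, g x) := by
  set w := wr L r₁ with hw
  have hw0 : 0 < w := by rw [hw]; unfold wr; positivity
  have hw1 : w ≤ 1 := by
    refine le_trans ?_ hr1
    rw [hw]; unfold wr
    rw [div_div]
    exact div_le_self hr.le (by nlinarith)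
  obtain ⟨t, htR, hcov⟩ := (isCompact_closedBall (0:E3) R').elim_nhds_subcover (fun z => ball z (w/2/2))
    (fun z _ => ball_mem_nhds z (by positivity))
  set K3 := 4 * ENNReal.ofReal ((8*L)^3) * (1 + CK L) + 2 * CK L with hK3
  have hK3t : K3 ≠ ∞ := by have := CK_ne L; rw [hK3]; finiteness
  refine ⟨t.card * Mseq K3 t.card, by have := Mseq_ne hK3t t.card; finiteness, ?_⟩
  intro Ω hΩ hcon hfar hch V _ f g K R hBP hR hf hg hK hfin
  set G := K * ∫⁻ x in Ω, g x
  set B := ∫⁻ x in Ω ∩ {x | R' - 1 < ‖x‖ ∧ ‖x‖ < R' + 2}, ‖f x‖ₑ^2 with hB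
  have key := chain hΩ hcon (d := w/2) (by positivity) (by linarith) hfar t
    (fun z hz => mem_closedBall_zero_iff.1 (htR z hz)) hcov
    (fun q => ∫⁻ x in Ω ∩ ball q w, ‖f x‖ₑ^2) B G K3
    (fun q _ q' hq' hd => step hL hr hch hBP hR hf hg hK hfin hq' hd)
    (fun q _ h1 h2 => by
      apply lintegral_mono_set
      apply inter_subset_inter_right
      intro x hx
      rw [mem_ball_iff_norm] at hx
      have h3 := norm_add_le (x - q) q
      rw [sub_add_cancel] at h3
      have h4 := norm_sub_norm_le q x
      rw [norm_sub_rev] at h4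
      constructor <;> linarith)
  have hcell : ∀ z ∈ t, ∫⁻ x in Ω ∩ ball z (w/2/2), ‖f x‖ₑ^2 ≤ Mseq K3 t.card * (B + G) := by
    intro z hz
    by_cases hne : (Ω ∩ ball z (w/2/2)).Nonempty
    · obtain ⟨q, hq⟩ := hne
      refine le_trans (lintegral_mono_set ?_) (key z hz q hq)
      apply inter_subset_inter_right
      apply ball_subset_ball'
      have := mem_ball'.1 hq.2
      linarith
    · rw [not_nonempty_iff_eq_empty.1 hne]; simp
  calc _ ≤ ∫⁻ x in ⋃ z ∈ t, Ω ∩ ball z (w/2/2), ‖f x‖ₑ^2 := by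
        apply lintegral_mono_set
        rintro x ⟨h1, h2⟩
        obtain ⟨z, hz, hxz⟩ := mem_iUnion₂.1 (hcov h2)
        exact mem_iUnion₂.2 ⟨z, hz, h1, hxz⟩
    _ ≤ ∑ z ∈ t, ∫⁻ x in Ω ∩ ball z (w/2/2), ‖f x‖ₑ^2 := by
        rw [← Finset.sum_attach]
        calc _ = ∫⁻ x in ⋃ z : t, Ω ∩ ball (z:E3) (w/2/2), ‖f x‖ₑ^2 := by
              congr 2; rw [iUnion_subtype]
          _ ≤ ∑' z : t, ∫⁻ x in Ω ∩ ball (z:E3) (w/2/2), ‖f x‖ₑ^2 := lintegral_iUnion_le _ _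
          _ = _ := by rw [tsum_fintype]; rfl
    _ ≤ ∑ z ∈ t, Mseq K3 t.card * (B + G) := Finset.sum_le_sum hcell
    _ = _ := by rw [Finset.sum_const, nsmul_eq_mul]; ring


def e3 : E3 := EuclideanSpace.single 2 1

lemma e3_norm : ‖e3‖ = 1 := by simp [e3]

lemma abs_coord (x : E3) (i : Fin 3) : |x i| ≤ ‖x‖ := by
  have := PiLp.norm_apply_le x i
  simpa using this

lemma proj12_sub (a b : E3) : ‖proj12 a - proj12 b‖ ≤ ‖a - b‖ := by
  rw [EuclideanSpace.norm_eq, EuclideanSpace.norm_eq]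
  apply Real.sqrt_le_sqrt
  simp [proj12, Fin.sum_univ_succ]
  positivity

lemma proj12_zero : proj12 0 = 0 := by simp [proj12]

lemma proj12_e3 (a : E3) (t : ℝ) : proj12 (a + t • e3) = proj12 a := by
  simp [proj12, e3]

lemma e3_coord (a : E3) (t : ℝ) : (a + t • e3) 2 = a 2 + t := by
  simp [e3]

lemma hf_plane {L : ℝ} (hL : 1 ≤ L) : HF (fun x => - x 2) (-e3) L where
  one_le := hL
  norm_n := by rw [norm_neg, e3_norm]
  lip x y := by
    have := abs_coord (x - y) 2
    have h2 : |(-x 2) - (- y 2)| = |(x - y) 2| := by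
      rw [← abs_neg]; congr 1; simp; ring
    rw [h2]
    nlinarith [norm_nonneg (x - y)]
  shift x t := by
    have : x + t • (-e3) = x + (-t) • e3 := by simp
    rw [this, e3_coord]; ring

lemma iso_shift (φ : E3 ≃ᵢ E3) : ∃ n : E3, ‖n‖ = 1 ∧ ∀ x (t : ℝ), φ (x + t • n) = φ x + (-t) • e3 := by
  set Φ := φ.toRealAffineIsometryEquiv with hΦ
  have hc : ∀ x, Φ x = φ x := fun x => by rw [hΦ]; simp
  refine ⟨Φ.linearIsometryEquiv.symm (-e3), by simp [e3_norm], fun x t => ?_⟩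
  rw [← hc, ← hc]
  have := Φ.map_vadd x (t • Φ.linearIsometryEquiv.symm (-e3))
  rw [vadd_eq_add, vadd_eq_add, add_comm, map_smul, LinearIsometryEquiv.apply_symm_apply] at this
  rw [this, add_comm]; simp

lemma hf_graph {E₀ : ℝ} (hE : 0 ≤ E₀) (φ : E3 ≃ᵢ E3) (ψ : E2 → ℝ) (hψ : LipschitzWith E₀.toNNReal ψ)
    {n : E3} (hn : ‖n‖ = 1) (hs : ∀ x (t : ℝ), φ (x + t • n) = φ x + (-t) • e3) :
    HF (fun x => ψ (proj12 (φ x)) - φ x 2) n (E₀ + 1) where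
  one_le := by linarith
  norm_n := hn
  lip x y := by
    have h1 := hψ.dist_le_mul (proj12 (φ x)) (proj12 (φ y))
    rw [Real.dist_eq, dist_eq_norm, Real.coe_toNNReal _ hE] at h1
    have h2 := proj12_sub (φ x) (φ y)
    have h3 := abs_coord (φ x - φ y) 2
    have h4 : ‖φ x - φ y‖ = ‖x - y‖ := by rw [← dist_eq_norm, φ.dist_eq, dist_eq_norm]
    rw [h4] at h2 h3
    rw [PiLp.sub_apply] at h3
    have h5 : |ψ (proj12 (φ x)) - ψ (proj12 (φ y))| ≤ E₀ * ‖x - y‖ :=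
      h1.trans (mul_le_mul_of_nonneg_left h2 hE)
    rw [abs_le] at h3 h5 ⊢
    constructor <;> nlinarith [h3.1, h3.2, h5.1, h5.2]
  shift x t := by
    simp only [hs, proj12_e3, e3_coord]; ring

section cav
variable {r₀ E₀ D₀ : ℝ} {C : Set E3}

lemma cl_low (hC : IsCavity D₀ C) {x : E3} (hx : x ∈ closure C) : x 2 ≤ -D₀ := by
  have : closure C ⊆ {x : E3 | x 2 ≤ -D₀} :=
    closure_minimal (fun y hy => hC.2.2.2.2.2.1 y hy) (isClosed_le (by fun_prop) continuous_const)
  exact this hx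

lemma cl_norm (hC : IsCavity D₀ C) {x : E3} (hx : x ∈ closure C) : ‖x‖ ≤ 2 * D₀ := by
  have : closure C ⊆ {x : E3 | ‖x‖ ≤ 2 * D₀} :=
    closure_minimal (fun y hy => (hC.2.2.2.2.1 hy).1.le) (isClosed_le (by fun_prop) continuous_const)
  exact this hx

lemma low_open : IsOpen lowerHalf := isOpen_lt (by fun_prop) continuous_const

lemma om_open : IsOpen (lowerHalf \ closure C) := low_open.sdiff isClosed_closure

lemma charts (hr₀ : 0 < r₀) (hE₀ : 0 < E₀) (hD₀ : 1 < D₀) (hC : IsLipschitzCavity r₀ E₀ D₀ C) {P : E3}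
    (hP : P ∈ frontier (lowerHalf \ closure C)) : Chart (lowerHalf \ closure C) P (E₀ + 1) (min r₀ 1) := by
  obtain ⟨hC, hb⟩ := hC
  by_cases hPC : P ∈ closure C
  · -- cavity boundary
    have hPf : P ∈ frontier C := by
      refine ⟨hPC, fun hi => ?_⟩
      have h1 := hP.1
      rw [_root_.mem_closure_iff] at h1
      obtain ⟨y, hy1, hy2⟩ := h1 _ isOpen_interior hi
      exact hy2.2 (subset_closure (interior_subset hy1))
    obtain ⟨φ, ψ, hφ, hψ0, hψ, hS⟩ := hb P hPf
    obtain ⟨ψ', hψ', heq⟩ := hψ.extend_real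
    obtain ⟨n, hn, hs⟩ := iso_shift φ
    have hHF := hf_graph hE₀.le φ ψ' hψ' hn hs
    have hpb : ∀ x ∈ ball P r₀, φ x ∈ ball (0:E3) r₀ ∧ proj12 (φ x) ∈ ball (0:E2) r₀ := by
      intro x hx
      have h1 : φ x ∈ ball (0:E3) r₀ := by
        rw [mem_ball, ← hφ, φ.dist_eq]; exact hx
      refine ⟨h1, ?_⟩
      have := proj12_sub (φ x) 0
      rw [proj12_zero, sub_zero, sub_zero] at this
      rw [mem_ball_zero_iff] at h1 ⊢
      linarith
    have hmem : ∀ x ∈ ball P r₀, x ∈ C ↔ ψ' (proj12 (φ x)) < φ x 2 := by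
      intro x hx
      obtain ⟨h1, h2⟩ := hpb x hx
      have : φ x ∈ (φ '' C) ∩ ball 0 r₀ ↔ φ x ∈ {x ∈ Metric.ball (0 : E3) r₀ | ψ (proj12 x) < x 2} := by rw [hS]
      simp only [mem_inter_iff, h1, and_true, mem_setOf_eq, true_and, φ.injective.mem_set_image] at this
      rw [this, heq h2]
    refine ⟨_, n, hHF, ?_, ?_⟩
    · simp only [hφ, proj12_zero, ← heq (mem_ball_self hr₀), hψ0]; simp
    intro x hx
    have hxr : x ∈ ball P r₀ := ball_subset_ball (min_le_left _ _) hx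
    have hx1 : x ∈ ball P 1 := ball_subset_ball (min_le_right _ _) hx
    have hxl : x ∈ lowerHalf := by
      have h1 := cl_low hC hPC
      have h2 := abs_coord (x - P) 2
      rw [mem_ball, dist_eq_norm] at hx1
      rw [PiLp.sub_apply] at h2
      have := (abs_le.1 h2).2
      show x 2 < 0
      linarith
    have hcont := hHF.cont
    constructor
    · intro hxO
      by_contra hneg
      push Not at hneg
      apply hxO.2
      rw [_root_.mem_closure_iff]
      intro o ho hxo
      have ht : Tendsto (fun t : ℝ => x + t • n) (𝓝[<] 0) (𝓝 x) := by
        have : Continuous (fun t : ℝ => x + t • n) := by fun_prop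
        have h := this.tendsto 0
        simp only [zero_smul, add_zero] at h
        exact h.mono_left nhdsWithin_le_nhds
      have e1 := ht.eventually (ho.mem_nhds hxo)
      have e2 := ht.eventually (isOpen_ball.mem_nhds hxr)
      obtain ⟨t, h1, h2, h3⟩ := (e1.and (e2.and self_mem_nhdsWithin)).exists
      refine ⟨_, h1, (hmem _ h2).2 ?_⟩
      have h4 := hHF.shift x t
      simp only at h4 hneg
      linarith
    · intro hpos
      refine ⟨hxl, fun hcl => ?_⟩
      rw [_root_.mem_closure_iff] at hcl
      have ho : IsOpen (ball P r₀ ∩ {y | 0 < ψ' (proj12 (φ y)) - φ y 2}) :=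
        isOpen_ball.inter (isOpen_lt continuous_const hcont)
      obtain ⟨y, hy1, hy2⟩ := hcl _ ho ⟨hxr, hpos⟩
      have := (hmem y hy1.1).1 hy2
      have h3 := hy1.2
      simp only [mem_setOf_eq] at h3
      linarith
  · have hP0 : P 2 = 0 := by
      have h1 : P ∈ closure lowerHalf := closure_mono diff_subset hP.1
      have h2 : P 2 ≤ 0 := by
        have : closure lowerHalf ⊆ {x : E3 | x 2 ≤ 0} :=
          closure_minimal (fun y (hy : y 2 < 0) => show y 2 ≤ 0 from hy.le) (isClosed_le (by fun_prop) continuous_const)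
        exact this h1
      rcases h2.lt_or_eq with h | h
      · exfalso
        apply hP.2
        rw [om_open.interior_eq]
        exact ⟨h, hPC⟩
      · exact h
    refine ⟨_, _, hf_plane (by linarith), by simp [hP0], fun x hx => ?_⟩
    have hx1 : x ∈ ball P 1 := ball_subset_ball (min_le_right _ _) hx
    have h2 := abs_coord (x - P) 2
    rw [mem_ball, dist_eq_norm] at hx1
    rw [PiLp.sub_apply, hP0] at h2
    have := (abs_le.1 h2).1
    constructor
    · intro h
      have : x 2 < 0 := h.1
      linarith
    · intro h
      refine ⟨by show x 2 < 0; linarith, fun hc => ?_⟩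
      have := cl_low hC hc
      linarith

end cav


def outD (D₀ : ℝ) : Set E3 := lowerHalf ∩ {x | 4 * D₀ < ‖x‖}

lemma outD_open (D₀ : ℝ) : IsOpen (outD D₀) :=
  low_open.inter (isOpen_lt continuous_const continuous_norm)

section cav
variable {r₀ E₀ D₀ : ℝ} {C : Set E3}

lemma outD_sub (hD₀ : 1 < D₀) (hC : IsCavity D₀ C) : outD D₀ ⊆ lowerHalf \ closure C := by
  rintro x ⟨h1, h2⟩
  refine ⟨h1, fun h => ?_⟩
  have := cl_norm hC h
  have h2' : 4 * D₀ < ‖x‖ := h2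
  linarith

lemma om_far (hD₀ : 1 < D₀) (hC : IsCavity D₀ C) (R : ℝ) : ∃ q ∈ lowerHalf \ closure C, R < ‖q‖ := by
  set t := |R| + 4 * D₀ + 1 with ht
  have htp : 0 < t := by positivity
  have hn : ‖(-t) • e3‖ = t := by rw [norm_smul, e3_norm]; simp [abs_of_pos htp]
  refine ⟨(-t) • e3, outD_sub hD₀ hC ⟨?_, ?_⟩, ?_⟩
  · show ((-t) • e3) 2 < 0
    have := e3_coord 0 (-t)
    rw [zero_add] at this
    rw [this]; simp [htp]
  · show 4 * D₀ < _
    rw [hn]; linarith [abs_nonneg R]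
  · rw [hn]; linarith [le_abs_self R]

lemma om_cover (R : ℝ) (hR : 4 * D₀ < R) :
    lowerHalf \ closure C ⊆ ((lowerHalf \ closure C) ∩ closedBall 0 R) ∪ outD D₀ := by
  intro x hx
  by_cases h : ‖x‖ ≤ R
  · left; exact ⟨hx, by simpa using h⟩
  · right; exact ⟨hx.1, by show 4 * D₀ < ‖x‖; linarith⟩

lemma om_ann (R : ℝ) (hR : 4 * D₀ < R - 1) :
    (lowerHalf \ closure C) ∩ {x | R - 1 < ‖x‖ ∧ ‖x‖ < R + 2} ⊆ outD D₀ := by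
  rintro x ⟨hx, h1, h2⟩
  exact ⟨hx.1, by show 4 * D₀ < ‖x‖; linarith⟩

lemma norm_down {x : E3} (hx : x 2 < 0) {t : ℝ} (ht : 0 ≤ t) : ‖x‖ ≤ ‖x + t • (-e3)‖ := by
  rw [← sq_le_sq₀ (norm_nonneg _) (norm_nonneg _), EuclideanSpace.norm_sq_eq, EuclideanSpace.norm_sq_eq]
  simp [Fin.sum_univ_succ, e3]
  nlinarith

lemma korn_total (hr₀ : 0 < r₀) (hE₀ : 0 < E₀) (hD₀ : 1 < D₀) : ∃ M : ℝ≥0∞, M ≠ ∞ ∧ ∀ C : Set E3,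
    IsLipschitzCavity r₀ E₀ D₀ C → ∀ u : E3 → E3, ContDiffOn ℝ 1 u (lowerHalf \ closure C) →
    ∫⁻ x in lowerHalf \ closure C, ‖fderiv ℝ u x‖ₑ^2 ≠ ∞ →
    ∫⁻ x in lowerHalf \ closure C, ‖fderiv ℝ u x‖ₑ^2 ≤ M * ∫⁻ x in lowerHalf \ closure C, es u x := by
  obtain ⟨K, hK⟩ := korn_ball
  obtain ⟨M, hM, hb⟩ := bounded_part (E₀ + 1) (min r₀ 1) (8 * D₀ + 2) (by linarith) (by positivity) (min_le_right _ _)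
  set c := ENNReal.ofReal (442368*(2*(1+(1/32:ℝ))/(1/32:ℝ))*(1+2/(1/32:ℝ))) with hc
  have hct : c ≠ ∞ := ENNReal.ofReal_ne_top
  refine ⟨M * (c * K + K) + c * K, by finiteness, fun C hC u hu hfin => ?_⟩
  set Ω := lowerHalf \ closure C with hΩ
  have hBP : BP (fderiv ℝ u) (es u) Ω K ∞ := fun x ρ h1 _ h3 => hK Ω u om_open hu x ρ h1 h3
  have hsm : StronglyMeasurable (fderiv ℝ u) := (measurable_fderiv ℝ u).stronglyMeasurable
  have hKt : (K : ℝ≥0∞) ≠ ∞ := ENNReal.coe_ne_top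
  have hDΩ := outD_sub hD₀ hC.1
  have hout : ∫⁻ x in outD D₀, ‖fderiv ℝ u x‖ₑ^2 ≤ c * (K * ∫⁻ x in Ω, es u x) := by
    have h := (hf_plane (L := 2) (by norm_num)).stretch (Y := ∅) hBP hsm (measurable_es u) hKt (ε := 1/32)
      (by norm_num) (by norm_num) (outD_open D₀).measurableSet ?_ ?_ ?_
    · simpa [hc] using h
    · rintro x ⟨h1, h2⟩
      have h1' : x 2 < 0 := h1
      have h2' : 4 * D₀ < ‖x‖ := h2
      refine ⟨by linarith, fun y hy => ?_, le_top⟩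
      rw [mem_ball, dist_eq_norm] at hy
      have a1 := abs_le.1 (abs_coord (y - x) 2)
      have a2 := abs_le.1 (abs_coord x 2)
      rw [PiLp.sub_apply] at a1
      have a3 : ‖x‖ ≤ ‖y‖ + ‖y - x‖ := by
        have := norm_sub_le y (y - x)
        simpa using this
      refine ⟨?_, fun h => ?_⟩
      · show y 2 < 0
        linarith [a1.2]
      · have := cl_norm hC.1 h
        linarith [a2.1]
    · rintro x ⟨h1, h2⟩
      have h1' : x 2 < 0 := h1
      have h2' : 4 * D₀ < ‖x‖ := h2
      left
      have ht : 0 ≤ 1/32 * -x 2 := by linarith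
      refine ⟨?_, lt_of_lt_of_le h2' (norm_down h1' ht)⟩
      show (x + (1/32 * -x 2) • (-e3)) 2 < 0
      have : x + (1/32 * -x 2) • (-e3) = x + (-(1/32 * -x 2)) • e3 := by simp
      rw [this, e3_coord]; linarith
    · exact ne_top_of_le_ne_top hfin (lintegral_mono_set hDΩ)
  have hin := hb Ω om_open hC.1.2.2.2.1.isPreconnected (om_far hD₀ hC.1 _) (fun P hP => charts hr₀ hE₀ hD₀ hC hP)
    _ (fderiv ℝ u) (es u) K ∞ hBP le_top hsm (measurable_es u) hKt
    (fun r => ne_top_of_le_ne_top hfin (lintegral_mono_set inter_subset_left))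
  calc ∫⁻ x in Ω, ‖fderiv ℝ u x‖ₑ^2
      ≤ ∫⁻ x in (Ω ∩ closedBall 0 (8*D₀+2)) ∪ outD D₀, ‖fderiv ℝ u x‖ₑ^2 :=
        lintegral_mono_set (om_cover _ (by linarith))
    _ ≤ (∫⁻ x in (Ω ∩ closedBall 0 (8*D₀+2)), ‖fderiv ℝ u x‖ₑ^2) + ∫⁻ x in outD D₀, ‖fderiv ℝ u x‖ₑ^2 :=
        lintegral_union_le _ _ _
    _ ≤ M * (c * (K * ∫⁻ x in Ω, es u x) + K * ∫⁻ x in Ω, es u x) + c * (K * ∫⁻ x in Ω, es u x) := by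
        refine add_le_add (hin.trans ?_) hout
        gcongr
        exact (lintegral_mono_set (om_ann _ (by linarith))).trans hout
    _ = _ := by ring

end cav

lemma sq_weighted (a b : E3) : ‖a‖ₑ^2 ≤ ENNReal.ofReal (3/2) * ‖b‖ₑ^2 + ENNReal.ofReal 3 * ‖b - a‖ₑ^2 := by
  simp only [enorm_sq_eq]
  rw [← ENNReal.ofReal_mul (by norm_num), ← ENNReal.ofReal_mul (by norm_num), ← ENNReal.ofReal_add (by positivity) (by positivity)]
  apply ENNReal.ofReal_le_ofReal
  have h : ‖a‖ ≤ ‖b‖ + ‖b - a‖ := by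
    have := norm_sub_le b (b - a)
    simpa using this
  nlinarith [norm_nonneg a, norm_nonneg b, norm_nonneg (b - a), sq_nonneg (‖b‖ - 2 * ‖b - a‖)]

lemma outD_smul {D₀ : ℝ} (hD₀ : 0 < D₀) {x : E3} (hx : x ∈ outD D₀) {t : ℝ} (ht : 1 ≤ t) : t • x ∈ outD D₀ := by
  obtain ⟨h1, h2⟩ := hx
  have h1' : x 2 < 0 := h1
  have h2' : 4 * D₀ < ‖x‖ := h2
  constructor
  · show (t • x) 2 < 0
    rw [PiLp.smul_apply, smul_eq_mul]
    nlinarith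
  · show 4 * D₀ < ‖t • x‖
    rw [norm_smul, Real.norm_of_nonneg (by linarith)]
    nlinarith

lemma hardy {D₀ : ℝ} (hD₀ : 1 < D₀) {u f : E3 → E3} (hu : ContDiffOn ℝ 1 u (outD D₀)) (hf : Measurable f)
    (hfu : ∀ x ∈ outD D₀, f x = u x)
    (hfin : ∫⁻ x in outD D₀, ‖f x‖ₑ^2 * ENNReal.ofReal ((‖x‖^2)⁻¹) ≠ ∞) :
    ∫⁻ x in outD D₀, ‖f x‖ₑ^2 * ENNReal.ofReal ((‖x‖^2)⁻¹) ≤ 12 * ∫⁻ x in outD D₀, ‖fderiv ℝ u x‖ₑ^2 := by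
  set D := outD D₀ with hD
  have hDm : MeasurableSet D := (outD_open D₀).measurableSet
  set I := ∫⁻ x in D, ‖f x‖ₑ^2 * ENNReal.ofReal ((‖x‖^2)⁻¹) with hI
  set G := ∫⁻ x in D, ‖fderiv ℝ u x‖ₑ^2 with hG
  have h2D : ∀ x ∈ D, (2:ℝ) • x ∈ D := fun x hx => outD_smul (by linarith) hx (by norm_num)
  have hA : ∫⁻ x in D, ‖f ((2:ℝ) • x)‖ₑ^2 * ENNReal.ofReal ((‖x‖^2)⁻¹) ≤ ENNReal.ofReal (1/2) * I := by
    have h := lint_affine (D.indicator fun x => ‖f x‖ₑ^2 * ENNReal.ofReal ((‖x‖^2)⁻¹)) 0 (r := 2) (by norm_num)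
    rw [lintegral_indicator hDm, ← hI] at h
    calc ∫⁻ x in D, ‖f ((2:ℝ) • x)‖ₑ^2 * ENNReal.ofReal ((‖x‖^2)⁻¹)
        = ∫⁻ x, D.indicator (fun x => ‖f ((2:ℝ) • x)‖ₑ^2 * ENNReal.ofReal ((‖x‖^2)⁻¹)) x := by
          rw [lintegral_indicator hDm]
      _ ≤ ∫⁻ x, ENNReal.ofReal 4 * D.indicator (fun x => ‖f x‖ₑ^2 * ENNReal.ofReal ((‖x‖^2)⁻¹)) (0 + (2:ℝ) • x) := by
          apply lintegral_mono
          intro x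
          by_cases hx : x ∈ D
          · simp only [indicator_of_mem hx, zero_add, indicator_of_mem (h2D x hx)]
            rw [mul_left_comm, ← ENNReal.ofReal_mul (by norm_num)]
            gcongr
            rw [norm_smul, Real.norm_of_nonneg (by norm_num : (0:ℝ) ≤ 2), mul_pow, mul_inv, ← mul_assoc]
            norm_num
          · simp [indicator_of_notMem hx]
      _ = ENNReal.ofReal (1/2) * I := by
          rw [lintegral_const_mul' _ _ ENNReal.ofReal_ne_top, h, ← mul_assoc, ← ENNReal.ofReal_mul (by norm_num)]
          norm_num
  have hB : ∫⁻ x in D, ‖f ((2:ℝ) • x) - f x‖ₑ^2 * ENNReal.ofReal ((‖x‖^2)⁻¹) ≤ G := by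
    have hmeas : Measurable (fun p : E3 × ℝ => ‖fderiv ℝ u ((1 + p.2) • p.1)‖ₑ^2) :=
      (((measurable_fderiv ℝ u).comp (by fun_prop)).enorm).pow_const 2
    calc ∫⁻ x in D, ‖f ((2:ℝ) • x) - f x‖ₑ^2 * ENNReal.ofReal ((‖x‖^2)⁻¹)
        ≤ ∫⁻ x in D, ∫⁻ t in Icc (0:ℝ) 1, ‖fderiv ℝ u ((1 + t) • x)‖ₑ^2 := by
          apply setLIntegral_mono' hDm
          intro x hx
          rw [hfu _ (h2D x hx), hfu x hx]
          have hx2 : 0 < ‖x‖ := by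
            have h2' : 4 * D₀ < ‖x‖ := hx.2
            linarith
          have e1 : (2:ℝ) • x - x = x := by module
          have e2 : ∀ t : ℝ, x + t • x = (1 + t) • x := fun t => by module
          have hl := line_u (outD_open D₀) hu (x := x) (y := (2:ℝ) • x) (fun t ht => by
            rw [e1, e2]; exact outD_smul (by linarith) hx (by linarith [ht.1]))
          simp only [e1, e2] at hl
          calc _ ≤ (‖x‖ₑ^2 * ∫⁻ t in Icc (0:ℝ) 1, ‖fderiv ℝ u ((1 + t) • x)‖ₑ^2) * ENNReal.ofReal ((‖x‖^2)⁻¹) := by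
                gcongr
            _ = _ := by
                rw [mul_right_comm, enorm_sq_eq, ← ENNReal.ofReal_mul (by positivity), mul_inv_cancel₀ (by positivity)]
                simp
      _ = ∫⁻ t in Icc (0:ℝ) 1, ∫⁻ x in D, ‖fderiv ℝ u ((1 + t) • x)‖ₑ^2 :=
          lintegral_lintegral_swap hmeas.aemeasurable
      _ ≤ ∫⁻ t in Icc (0:ℝ) 1, G := by
          apply setLIntegral_mono' measurableSet_Icc
          intro t ht
          have h := lint_affine (D.indicator fun x => ‖fderiv ℝ u x‖ₑ^2) 0 (r := 1 + t) (by linarith [ht.1])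
          rw [lintegral_indicator hDm, ← hG] at h
          calc ∫⁻ x in D, ‖fderiv ℝ u ((1 + t) • x)‖ₑ^2
              = ∫⁻ x, D.indicator (fun x => ‖fderiv ℝ u ((1 + t) • x)‖ₑ^2) x := by
                rw [lintegral_indicator hDm]
            _ ≤ ∫⁻ x, (D.indicator fun x => ‖fderiv ℝ u x‖ₑ^2) (0 + (1+t) • x) := by
                apply lintegral_mono
                intro x
                by_cases hx : x ∈ D
                · have : (1+t) • x ∈ D := outD_smul (by linarith) hx (by linarith [ht.1])
                  simp only [indicator_of_mem hx, zero_add, indicator_of_mem this]; exact le_rfl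
                · simp [indicator_of_notMem hx]
            _ = _ := h
            _ ≤ 1 * G := by
                gcongr
                rw [ENNReal.ofReal_le_one]
                apply inv_le_one_of_one_le₀
                exact one_le_pow₀ (by linarith [ht.1])
            _ = G := one_mul _
      _ = G := by simp
  have hmain : I ≤ ENNReal.ofReal (3/4) * I + ENNReal.ofReal 3 * G := by
    have hm : Measurable (fun x : E3 => ‖f ((2:ℝ) • x)‖ₑ^2 * ENNReal.ofReal ((‖x‖^2)⁻¹)) :=
      ((hf.comp (by fun_prop : Measurable fun x : E3 => (2:ℝ) • x)).enorm.pow_const 2).mul (by fun_prop)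
    calc I ≤ ∫⁻ x in D, (ENNReal.ofReal (3/2) * (‖f ((2:ℝ) • x)‖ₑ^2 * ENNReal.ofReal ((‖x‖^2)⁻¹)) +
            ENNReal.ofReal 3 * (‖f ((2:ℝ) • x) - f x‖ₑ^2 * ENNReal.ofReal ((‖x‖^2)⁻¹))) := by
          apply lintegral_mono
          intro x
          have := sq_weighted (f x) (f ((2:ℝ) • x))
          calc _ ≤ (ENNReal.ofReal (3/2) * ‖f ((2:ℝ) • x)‖ₑ^2 + ENNReal.ofReal 3 * ‖f ((2:ℝ) • x) - f x‖ₑ^2) * ENNReal.ofReal ((‖x‖^2)⁻¹) :=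
                mul_le_mul_left this _
            _ = _ := by ring
      _ = ENNReal.ofReal (3/2) * (∫⁻ x in D, ‖f ((2:ℝ) • x)‖ₑ^2 * ENNReal.ofReal ((‖x‖^2)⁻¹)) +
            ENNReal.ofReal 3 * ∫⁻ x in D, ‖f ((2:ℝ) • x) - f x‖ₑ^2 * ENNReal.ofReal ((‖x‖^2)⁻¹) := by
          rw [lintegral_add_left (hm.const_mul _), lintegral_const_mul' _ _ ENNReal.ofReal_ne_top,
            lintegral_const_mul' _ _ ENNReal.ofReal_ne_top]
      _ ≤ ENNReal.ofReal (3/2) * (ENNReal.ofReal (1/2) * I) + ENNReal.ofReal 3 * G := by gcongr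
      _ = _ := by
          rw [← mul_assoc, ← ENNReal.ofReal_mul (by norm_num)]; norm_num
  by_cases hGt : G = ∞
  · rw [hGt]; simp
  lift I to ℝ≥0 using hfin with I'
  lift G to ℝ≥0 using hGt with G'
  have h3 : (I':ℝ) ≤ 3/4 * I' + 3 * G' := by
    have h := ENNReal.toReal_mono (by finiteness) hmain
    rw [ENNReal.toReal_add (by finiteness) (by finiteness), ENNReal.toReal_mul, ENNReal.toReal_mul] at h
    rw [ENNReal.toReal_ofReal (by norm_num), ENNReal.toReal_ofReal (by norm_num)] at h
    simpa using h
  have h4 : (I':ℝ) ≤ 12 * G' := by linarith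
  exact_mod_cast h4

section cav
variable {r₀ E₀ D₀ : ℝ} {C : Set E3}

lemma hardy_total (hr₀ : 0 < r₀) (hE₀ : 0 < E₀) (hD₀ : 1 < D₀) : ∃ M : ℝ≥0∞, M ≠ ∞ ∧ ∀ C : Set E3,
    IsLipschitzCavity r₀ E₀ D₀ C → ∀ u : E3 → E3, ContDiffOn ℝ 1 u (lowerHalf \ closure C) →
    ∫⁻ x in lowerHalf \ closure C, ‖u x‖ₑ^2 * ENNReal.ofReal ((1 + ‖x‖^2)⁻¹) ≠ ∞ →
    ∫⁻ x in lowerHalf \ closure C, ‖u x‖ₑ^2 * ENNReal.ofReal ((1 + ‖x‖^2)⁻¹) ≤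
      M * ∫⁻ x in lowerHalf \ closure C, ‖fderiv ℝ u x‖ₑ^2 := by
  obtain ⟨M, hM, hb⟩ := bounded_part (E₀ + 1) (min r₀ 1) (8 * D₀ + 2) (by linarith) (by positivity) (min_le_right _ _)
  set c := ENNReal.ofReal ((8 * D₀ + 4)^2) with hc
  have hct : c ≠ ∞ := ENNReal.ofReal_ne_top
  refine ⟨M * (c * 12 + ENNReal.ofReal 32) + 12, by finiteness, fun C hC u hu hfin => ?_⟩
  set Ω := lowerHalf \ closure C with hΩ
  have hDΩ := outD_sub hD₀ hC.1
  have hΩm : MeasurableSet Ω := om_open.measurableSet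
  have hDm : MeasurableSet (outD D₀) := (outD_open D₀).measurableSet
  set f := Ω.indicator u with hf
  have hfu : ∀ x ∈ Ω, f x = u x := fun x hx => indicator_of_mem hx _
  have hfm : Measurable f := by
    classical
    have : Measurable (Ω.piecewise u 0) := hu.continuousOn.measurable_piecewise (continuousOn_const (c := (0:E3))) hΩm
    rwa [piecewise_eq_indicator] at this
  have hgm : Measurable (fun x => ‖fderiv ℝ u x‖ₑ^2) := (measurable_fderiv ℝ u).enorm.pow_const 2
  have hBP : BP f (fun x => ‖fderiv ℝ u x‖ₑ^2) Ω (ENNReal.ofReal 32) 1 := by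
    intro x ρ h1 h2 h3
    have hsub : ball x ρ ⊆ ball x (2*ρ) := ball_subset_ball (by linarith)
    obtain ⟨a, ha⟩ := poincare_ball om_open hu h1 (hsub.trans h3)
    refine ⟨a, ?_⟩
    calc ∫⁻ y in ball x ρ, ‖f y - a‖ₑ^2 = ∫⁻ y in ball x ρ, ‖u y - a‖ₑ^2 :=
          setLIntegral_congr_fun measurableSet_ball fun y hy => by
            simp only [hfu y (h3 (hsub hy))]
      _ ≤ _ := ha
      _ ≤ _ := by
          gcongr
          rw [ENNReal.ofReal_le_one] at h2
          nlinarith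
  have hfin2 : ∫⁻ x in outD D₀, ‖f x‖ₑ^2 * ENNReal.ofReal ((‖x‖^2)⁻¹) ≠ ∞ := by
    refine ne_top_of_le_ne_top (b := ENNReal.ofReal 2 * ∫⁻ x in Ω, ‖u x‖ₑ^2 * ENNReal.ofReal ((1 + ‖x‖^2)⁻¹)) (by finiteness) ?_
    rw [← lintegral_const_mul' _ _ ENNReal.ofReal_ne_top]
    refine (setLIntegral_mono' hDm fun x hx => ?_).trans (lintegral_mono_set hDΩ)
    rw [hfu x (hDΩ hx), mul_left_comm, ← ENNReal.ofReal_mul (by norm_num)]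
    gcongr
    have h2' : 4 * D₀ < ‖x‖ := hx.2
    have hx1 : 1 < ‖x‖ := by linarith
    rw [inv_eq_one_div, ← div_eq_mul_inv, div_le_div_iff₀ (by positivity) (by positivity)]
    nlinarith
  have hout := hardy hD₀ (hu.mono hDΩ) hfm (fun x hx => hfu x (hDΩ hx)) hfin2
  have hout2 : ∫⁻ x in outD D₀, ‖f x‖ₑ^2 * ENNReal.ofReal ((‖x‖^2)⁻¹) ≤ 12 * ∫⁻ x in Ω, ‖fderiv ℝ u x‖ₑ^2 := by
    refine hout.trans ?_
    gcongr
  have hin := hb Ω om_open hC.1.2.2.2.1.isPreconnected (om_far hD₀ hC.1 _) (fun P hP => charts hr₀ hE₀ hD₀ hC hP)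
    _ f _ (ENNReal.ofReal 32) 1 hBP (by rw [ENNReal.ofReal_le_one]; exact min_le_right _ _) hfm.stronglyMeasurable
    hgm ENNReal.ofReal_ne_top
    (fun r => by
      refine ne_top_of_le_ne_top (b := ENNReal.ofReal (1 + r^2) * ∫⁻ x in Ω, ‖u x‖ₑ^2 * ENNReal.ofReal ((1 + ‖x‖^2)⁻¹)) (by finiteness) ?_
      rw [← lintegral_const_mul' _ _ ENNReal.ofReal_ne_top]
      refine (setLIntegral_mono' (hΩm.inter measurableSet_ball) fun x hx => ?_).trans (lintegral_mono_set inter_subset_left)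
      rw [hfu x hx.1, mul_left_comm, ← ENNReal.ofReal_mul (by positivity)]
      refine le_mul_of_one_le_right (by positivity) ?_
      rw [ENNReal.one_le_ofReal, ← div_eq_mul_inv, one_le_div (by positivity)]
      have : ‖x‖ < r := by simpa using hx.2
      nlinarith [norm_nonneg x])
  have hann : ∫⁻ x in Ω ∩ {x | 8 * D₀ + 2 - 1 < ‖x‖ ∧ ‖x‖ < 8 * D₀ + 2 + 2}, ‖f x‖ₑ^2 ≤
      c * (12 * ∫⁻ x in Ω, ‖fderiv ℝ u x‖ₑ^2) := by
    refine le_trans ?_ (mul_le_mul_right hout2 c)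
    rw [← lintegral_const_mul' _ _ hct]
    have hms : MeasurableSet {x : E3 | 8 * D₀ + 2 - 1 < ‖x‖ ∧ ‖x‖ < 8 * D₀ + 2 + 2} :=
      (measurableSet_lt measurable_const measurable_norm).inter (measurableSet_lt measurable_norm measurable_const)
    refine (setLIntegral_mono' (hΩm.inter hms) fun x hx => ?_).trans (lintegral_mono_set (om_ann _ (by linarith)))
    obtain ⟨-, h1, h2⟩ := hx
    have : 0 < ‖x‖ := by linarith
    rw [mul_left_comm, hc, ← ENNReal.ofReal_mul (by positivity)]
    refine le_mul_of_one_le_right (by positivity) ?_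
    rw [ENNReal.one_le_ofReal, ← div_eq_mul_inv, one_le_div (by positivity)]
    nlinarith
  have hw1 : ∀ x : E3, (1 + ‖x‖^2)⁻¹ ≤ 1 := fun x => inv_le_one_of_one_le₀ (by nlinarith [norm_nonneg x])
  set G := ∫⁻ x in Ω, ‖fderiv ℝ u x‖ₑ^2 with hG
  calc ∫⁻ x in Ω, ‖u x‖ₑ^2 * ENNReal.ofReal ((1 + ‖x‖^2)⁻¹)
      ≤ ∫⁻ x in (Ω ∩ closedBall 0 (8*D₀+2)) ∪ outD D₀, ‖u x‖ₑ^2 * ENNReal.ofReal ((1 + ‖x‖^2)⁻¹) :=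
        lintegral_mono_set (om_cover _ (by linarith))
    _ ≤ (∫⁻ x in (Ω ∩ closedBall 0 (8*D₀+2)), ‖u x‖ₑ^2 * ENNReal.ofReal ((1 + ‖x‖^2)⁻¹)) +
          ∫⁻ x in outD D₀, ‖u x‖ₑ^2 * ENNReal.ofReal ((1 + ‖x‖^2)⁻¹) :=
        lintegral_union_le _ _ _
    _ ≤ (∫⁻ x in (Ω ∩ closedBall 0 (8*D₀+2)), ‖f x‖ₑ^2) +
          ∫⁻ x in outD D₀, ‖f x‖ₑ^2 * ENNReal.ofReal ((‖x‖^2)⁻¹) := by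
        refine add_le_add (setLIntegral_mono' (hΩm.inter measurableSet_closedBall) fun x hx => ?_)
          (setLIntegral_mono' hDm fun x hx => ?_)
        · rw [hfu x hx.1]
          refine mul_le_of_le_one_right (by positivity) ?_
          rw [ENNReal.ofReal_le_one]; exact hw1 x
        · rw [hfu x (hDΩ hx)]
          have h2' : 4 * D₀ < ‖x‖ := hx.2
          have : 0 < ‖x‖ := by linarith
          gcongr
          linarith
    _ ≤ M * (c * (12 * G) + ENNReal.ofReal 32 * G) + 12 * G := by
        refine add_le_add (hin.trans ?_) hout2
        gcongr
    _ = _ := by ring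

end cav

section aux

lemma strain_le_jac (u : E3 → E3) (x : E3) : frob2 (strain u x) ≤ frob2 (jac u x) := by
  simp only [frob2, strain, Fin.sum_univ_three]
  nlinarith [sq_nonneg (jac u x 0 1 - jac u x 1 0), sq_nonneg (jac u x 0 2 - jac u x 2 0),
    sq_nonneg (jac u x 1 2 - jac u x 2 1)]

lemma div_le_strain (u : E3 → E3) (x : E3) : (divg u x)^2 ≤ 3 * frob2 (strain u x) := by
  simp only [frob2, divg, strain, Fin.sum_univ_three]
  nlinarith [sq_nonneg (jac u x 0 0 - jac u x 1 1), sq_nonneg (jac u x 0 0 - jac u x 2 2),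
    sq_nonneg (jac u x 1 1 - jac u x 2 2), sq_nonneg (jac u x 0 1 + jac u x 1 0),
    sq_nonneg (jac u x 0 2 + jac u x 2 0), sq_nonneg (jac u x 1 2 + jac u x 2 1)]

lemma conv_le {S A : ℝ} {M : ℝ≥0∞} (hM : M ≠ ∞) (hS : 0 ≤ S)
    (h : ENNReal.ofReal A ≤ M * ENNReal.ofReal S) : A ≤ M.toReal * S := by
  by_cases hA : 0 ≤ A
  · have := ENNReal.toReal_mono (by finiteness) h
    rwa [ENNReal.toReal_mul, ENNReal.toReal_ofReal hA, ENNReal.toReal_ofReal hS] at this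
  · have : 0 ≤ M.toReal * S := by positivity
    linarith

lemma coercive_aux (lam mu r₀ E₀ D₀ : ℝ)
    (hmu : 0 < mu) (hlam : 0 < 3*lam + 2*mu) (hr₀ : 0 < r₀) (hE₀ : 0 < E₀) (hD₀ : 1 < D₀) :
    ∃ c : ℝ, 0 < c ∧ ∀ C : Set E3, IsLipschitzCavity r₀ E₀ D₀ C →
      ∀ u : E3 → E3, ContDiffOn ℝ 1 u (lowerHalf \ closure C) →
      IntegrableOn (fun x => ‖u x‖^2 / (1 + ‖x‖^2)) (lowerHalf \ closure C) →
      IntegrableOn (fun x => frob2 (jac u x)) (lowerHalf \ closure C) →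
      c * ((∫ x in lowerHalf \ closure C, ‖u x‖^2 / (1 + ‖x‖^2)) +
            (∫ x in lowerHalf \ closure C, frob2 (jac u x))) ≤
        ∫ x in lowerHalf \ closure C, (lam * (divg u x)^2 + 2*mu * frob2 (strain u x)) := by
  obtain ⟨M1, hM1, hk⟩ := korn_total hr₀ hE₀ hD₀
  obtain ⟨M2, hM2, hh⟩ := hardy_total hr₀ hE₀ hD₀
  set κ := min (2*mu) (3*lam + 2*mu) with hκ
  have hκ0 : 0 < κ := lt_min (by linarith) hlam
  set m := (M2 * M1).toReal + (9 * M1).toReal + 1 with hm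
  have hm0 : 0 < m := by positivity
  refine ⟨κ / m, by positivity, fun C hC u hu hI1 hI2 => ?_⟩
  set Ω := lowerHalf \ closure C with hΩ
  have hms : Measurable (fun x => frob2 (strain u x)) := by
    unfold frob2 strain
    have := measurable_jac u
    fun_prop
  have hmd : Measurable (fun x => divg u x) := by
    unfold divg
    have := measurable_jac u
    fun_prop
  have hIs : IntegrableOn (fun x => frob2 (strain u x)) Ω := by
    refine hI2.mono' hms.aestronglyMeasurable (ae_of_all _ fun x => ?_)
    rw [Real.norm_of_nonneg (frob2_nonneg _)]
    exact strain_le_jac u x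
  have hId : IntegrableOn (fun x => (divg u x)^2) Ω := by
    refine (hIs.const_mul 3).mono' (hmd.pow_const 2).aestronglyMeasurable (ae_of_all _ fun x => ?_)
    rw [Real.norm_of_nonneg (sq_nonneg _)]
    exact div_le_strain u x
  have hIq : IntegrableOn (fun x => lam * (divg u x)^2 + 2*mu * frob2 (strain u x)) Ω :=
    (hId.const_mul lam).add (hIs.const_mul (2*mu))
  set S := ∫ x in Ω, frob2 (strain u x) with hS
  have hS0 : 0 ≤ S := integral_nonneg fun x => frob2_nonneg _
  have hq : κ * S ≤ ∫ x in Ω, (lam * (divg u x)^2 + 2*mu * frob2 (strain u x)) := by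
    rw [hS, ← integral_const_mul]
    refine integral_mono (hIs.const_mul κ) hIq fun x => ?_
    have h1 := div_le_strain u x
    have h2 := frob2_nonneg (strain u x)
    have h3 : κ ≤ 2*mu := min_le_left _ _
    have h4 : κ ≤ 3*lam+2*mu := min_le_right _ _
    show κ * frob2 (strain u x) ≤ lam * (divg u x)^2 + 2*mu * frob2 (strain u x)
    rcases le_total 0 lam with h | h
    · nlinarith [mul_nonneg h (sq_nonneg (divg u x))]
    · nlinarith
  have eS : ENNReal.ofReal S = ∫⁻ x in Ω, es u x :=
    ofReal_integral_eq_lintegral_ofReal hIs (ae_of_all _ fun x => frob2_nonneg _)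
  have eB := ofReal_integral_eq_lintegral_ofReal hI2 (ae_of_all _ fun x => frob2_nonneg _)
  have eA := ofReal_integral_eq_lintegral_ofReal hI1 (ae_of_all _ fun x => by positivity)
  have eA' : ∀ x : E3, ENNReal.ofReal (‖u x‖^2 / (1 + ‖x‖^2)) = ‖u x‖ₑ^2 * ENNReal.ofReal ((1 + ‖x‖^2)⁻¹) := by
    intro x
    rw [enorm_sq_eq, ← ENNReal.ofReal_mul (by positivity), div_eq_mul_inv]
  simp only [eA'] at eA
  have hfd : ∫⁻ x in Ω, ‖fderiv ℝ u x‖ₑ^2 ≠ ∞ := by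
    refine ne_top_of_le_ne_top ENNReal.ofReal_ne_top (le_trans (lintegral_mono fun x => ?_) eB.ge)
    rw [enorm_sq_eq]
    exact ENNReal.ofReal_le_ofReal (opnorm_frob _)
  have hK := hk C hC u hu hfd
  have hH := hh C hC u hu (by rw [← hΩ, ← eA]; exact ENNReal.ofReal_ne_top)
  rw [← hΩ] at hK hH
  rw [← eS] at hK
  have hA : ∫ x in Ω, ‖u x‖^2 / (1 + ‖x‖^2) ≤ (M2 * M1).toReal * S := by
    apply conv_le (by finiteness) hS0
    rw [eA, mul_assoc]
    exact hH.trans (by gcongr)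
  have hB : ∫ x in Ω, frob2 (jac u x) ≤ (9 * M1).toReal * S := by
    apply conv_le (by finiteness) hS0
    rw [eB, mul_assoc]
    calc ∫⁻ x in Ω, ENNReal.ofReal (frob2 (jac u x)) ≤ ∫⁻ x in Ω, 9 * ‖fderiv ℝ u x‖ₑ^2 := by
          refine lintegral_mono fun x => ?_
          rw [enorm_sq_eq, show (9:ℝ≥0∞) = ENNReal.ofReal 9 by norm_num, ← ENNReal.ofReal_mul (by norm_num)]
          exact ENNReal.ofReal_le_ofReal (frob_opnorm _)
      _ = 9 * ∫⁻ x in Ω, ‖fderiv ℝ u x‖ₑ^2 := lintegral_const_mul' _ _ (by norm_num)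
      _ ≤ _ := by gcongr
  refine le_trans ?_ hq
  rw [div_mul_eq_mul_div, div_le_iff₀ hm0, mul_assoc]
  apply mul_le_mul_of_nonneg_left _ hκ0.le
  calc _ ≤ (M2 * M1).toReal * S + (9 * M1).toReal * S := add_le_add hA hB
    _ ≤ S * m := by rw [hm]; nlinarith

end aux

end kornproof

/-- Coercivity of the elastic bilinear form on the weighted space:
`a(u,u) = ∫_Ω ℂ∇̂u : ∇̂u ≥ c ‖u‖²_{H¹_w(Ω)}`. -/
theorem bilinear_form_coercivity (lam mu r₀ E₀ D₀ : ℝ)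
    (hmu : 0 < mu) (hlam : 0 < 3*lam + 2*mu) (hr₀ : 0 < r₀) (hE₀ : 0 < E₀) (hD₀ : 1 < D₀) :
    ∃ c : ℝ, 0 < c ∧ ∀ C : Set E3, IsLipschitzCavity r₀ E₀ D₀ C →
      ∀ u : E3 → E3, ContDiffOn ℝ 1 u (lowerHalf \ closure C) →
      IntegrableOn (fun x => ‖u x‖^2 / (1 + ‖x‖^2)) (lowerHalf \ closure C) →
      IntegrableOn (fun x => frob2 (jac u x)) (lowerHalf \ closure C) →
      c * ((∫ x in lowerHalf \ closure C, ‖u x‖^2 / (1 + ‖x‖^2)) +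
            (∫ x in lowerHalf \ closure C, frob2 (jac u x))) ≤
        ∫ x in lowerHalf \ closure C, (lam * (divg u x)^2 + 2*mu * frob2 (strain u x)) := by
  exact coercive_aux lam mu r₀ E₀ D₀ hmu hlam hr₀ hE₀ hD₀

end
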